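/- arXiv:2111.05758 — 3 statements merged into one kernel-verified Lean document; each statement's English description precedes it below -/
import Mathlib

section
/- Let M = {1^{m_1}, ..., n^{m_n}} with all m_i ≥ 1 and total size M. Then Σ_{m≥0} C(M−n+m, m) · m^n · t^m = (M−n+1) · Q̄_M(t) / (1−t)^{M+1} as formal power series in t, where Q̄_M(t) = Σ_{π ∈ Q̄_M} t^{des(π)} is the descent polynomial of quasi-Stirling multipermutations of M. -/
open scoped Classical
open Finset MvPolynomial

/-- The word `w` padded with a `0` at the front and at the end; `pad w i` is the
`i`-th letter of `0, w_1, …, w_M, 0` (so `pad w 0 = 0 = pad w (M+1)`). -/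
def pad (w : List ℕ) : ℕ → ℕ := fun i => (0 :: (w ++ [0])).getD i 0

/-- number of descents (indices `0 ≤ i ≤ M` with `π_i > π_{i+1}`, convention `π_0 = π_{M+1} = 0`). -/
def desN (w : List ℕ) : ℕ :=
  ((Finset.range (w.length + 1)).filter fun i => pad w (i + 1) < pad w i).card

/-- number of ascents. -/
def ascN (w : List ℕ) : ℕ :=
  ((Finset.range (w.length + 1)).filter fun i => pad w i < pad w (i + 1)).card

/-- number of plateaus. -/
def platN (w : List ℕ) : ℕ :=
  ((Finset.range (w.length + 1)).filter fun i => pad w i = pad w (i + 1)).card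

/-- number of double descents: indices `1 ≤ i ≤ M` with `π_{i-1} > π_i > π_{i+1}`. -/
def ddN (w : List ℕ) : ℕ :=
  ((Finset.range w.length).filter fun i =>
    pad w (i + 1) < pad w i ∧ pad w (i + 2) < pad w (i + 1)).card

/-- number of cyclic descents: indices `1 ≤ i ≤ M` with `π_i > π_{i+1}`, cyclic convention
`π_{M+1} = π_1`. -/
def cdesN (w : List ℕ) : ℕ :=
  ((Finset.range w.length).filter fun i =>
    w.getD ((i + 1) % w.length) 0 < w.getD i 0).card

/-- number of cyclic ascents. -/
def cascN (w : List ℕ) : ℕ :=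
  ((Finset.range w.length).filter fun i =>
    w.getD i 0 < w.getD ((i + 1) % w.length) 0).card

/-- The permutations of `[n] = {1,…,n}`, as words (lists). -/
def Sn (n : ℕ) : Finset (List ℕ) := (List.range' 1 n).permutations.toFinset

/-- quasi-Stirling: no four positions `i<j<k<l` with `w_i = w_k`, `w_j = w_l`, `w_i ≠ w_j`
(no subword order-isomorphic to 1212 or 2121). -/
def IsQS (w : List ℕ) : Prop :=
  ¬ ∃ i j k l, i < j ∧ j < k ∧ k < l ∧ l < w.length ∧
      w.getD i 0 = w.getD k 0 ∧ w.getD j 0 = w.getD l 0 ∧ w.getD i 0 ≠ w.getD j 0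

/-- The multiset `{1^{m 1}, …, n^{m n}}`, written as a (weakly increasing) list. -/
def msetList (n : ℕ) (m : ℕ → ℕ) : List ℕ :=
  (List.range n).flatMap fun i => List.replicate (m (i + 1)) (i + 1)

/-- The finite set of quasi-Stirling multipermutations of `{1^{m 1}, …, n^{m n}}`. -/
noncomputable def QS (n : ℕ) (m : ℕ → ℕ) : Finset (List ℕ) :=
  (msetList n m).permutations.toFinset.filter IsQS

/-- `p` is a position of `w` holding a non-leftmost copy of its value. -/
def nonFirstPos (w : List ℕ) (p : ℕ) : Prop :=
  p < w.length ∧ ∃ q, q < p ∧ w.getD q 0 = w.getD p 0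

/-- Rooted quasi-Stirling multipermutations: pairs `(π, r)` where `π` is quasi-Stirling and
either `r = none` (rooted at `0`) or `r = some p` with `p` a position of a non-first copy. -/
noncomputable def RootedQS (n : ℕ) (m : ℕ → ℕ) : Finset (List ℕ × Option ℕ) :=
  ((QS n m) ×ˢ insert none ((Finset.range (msetList n m).length).image some)).filter
    fun P => ∀ r, P.2 = some r → nonFirstPos P.1 r

/-- Sum of the block sizes of the blocks preceding block `i`. -/
def offsetC {k : ℕ} (c : Fin k → ℕ) (i : Fin k) : ℕ :=
  ∑ j ∈ Finset.univ.filter (fun j : Fin k => (j : ℕ) < (i : ℕ)), c j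

/-- The `i`-th block of the ordered set partition encoded by the word `w` together with the
composition `c` of block sizes. -/
def blockOf (k : ℕ) (w : List ℕ) (c : Fin k → ℕ) (i : Fin k) : List ℕ :=
  (w.drop (offsetC c i)).take (c i)

/-- `B_{n,k}`: ordered set partitions of `[n]` into `k` possibly empty blocks, each block
written as a permutation of its elements; encoded as a pair `(w, c)` of a permutation word
`w` of `[n]` and a composition `c` of `n` into `k` nonnegative parts (the block sizes). -/
def Bnk (n k : ℕ) : Finset (List ℕ × (Fin k → ℕ)) :=
  Sn n ×ˢ Finset.Nat.antidiagonalTuple k n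

/-- blockwise descent number of an ordered set partition. -/
def desB {k : ℕ} (P : List ℕ × (Fin k → ℕ)) : ℕ := ∑ i, desN (blockOf k P.1 P.2 i)

/-- blockwise ascent number of an ordered set partition. -/
def ascB {k : ℕ} (P : List ℕ × (Fin k → ℕ)) : ℕ := ∑ i, ascN (blockOf k P.1 P.2 i)

/-- number of empty blocks of an ordered set partition. -/
def empB {k : ℕ} (P : List ℕ × (Fin k → ℕ)) : ℕ :=
  (Finset.univ.filter fun i => P.2 i = 0).card

/-- `A(x,y,u) = Σ_{n ≥ 0} A_n(x,y) uⁿ/n!`, power series in `u` with coefficients in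
`ℚ[x,y,z] = MvPolynomial (Fin 3) ℚ` (`x = X 0`, `y = X 1`, `z = X 2`). -/
noncomputable def AEGF3 : PowerSeries (MvPolynomial (Fin 3) ℚ) :=
  PowerSeries.mk fun j => (j.factorial : ℚ)⁻¹ •
    ∑ w ∈ Sn j, (X 0 : MvPolynomial (Fin 3) ℚ) ^ desN w * (X 1) ^ ascN w

/-- The global index of the `j`-th gap of block `i` (each block `i` has `c i + 1` gaps). -/
def gapIdx {k : ℕ} (c : Fin k → ℕ) (i : Fin k) (j : ℕ) : ℕ :=
  (∑ j' ∈ Finset.univ.filter (fun j' : Fin k => (j' : ℕ) < (i : ℕ)), (c j' + 1)) + j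

/-- A bar placement `b` (bars per gap, `n + k` gaps in total) is good for the ordered set
partition `(w, c) ∈ B_{n,k}` if every descent gap of every block receives at least one bar. -/
def GoodBars (n k : ℕ) (w : List ℕ) (c : Fin k → ℕ) (b : Fin (n + k) → ℕ) : Prop :=
  ∀ i : Fin k, ∀ j ≤ c i,
    pad (blockOf k w c i) (j + 1) < pad (blockOf k w c i) j →
      ∀ g : Fin (n + k), (g : ℕ) = gapIdx c i j → 1 ≤ b g

/-- `π_i` (1-indexed, `pad w i`) is the last copy of its value in `w`. -/
def lastCopy (w : List ℕ) (i : ℕ) : Prop :=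
  ∀ j, i < j → j ≤ w.length → pad w j ≠ pad w i

/-- `π_p` is the first copy of its value; by convention the boundary entry `π_{M+1} = 0`
is regarded as a second (non-first) copy of `0`. -/
def firstCopy (w : List ℕ) (p : ℕ) : Prop :=
  p ≤ w.length ∧ ∀ j, 1 ≤ j → j < p → pad w j ≠ pad w p

/-- sibling descent of type I at `i`: `π_{i+1}` is a first copy and `π_i > π_{i+1}`. -/
def TypeI (w : List ℕ) (i : ℕ) : Prop :=
  firstCopy w (i + 1) ∧ pad w (i + 1) < pad w i

/-- `i` is a sibling descent: `π_i` is a last copy, and either type I holds at `i` or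
`π_{i+1}` is a non-first copy (type II). -/
def SDes (w : List ℕ) (i : ℕ) : Prop :=
  lastCopy w i ∧ (TypeI w i ∨ ¬ firstCopy w (i + 1))

/-- number of sibling descents (indices `1 ≤ i ≤ M`). -/
noncomputable def sdN (w : List ℕ) : ℕ :=
  ((Finset.Icc 1 w.length).filter (SDes w)).card

/-- number of double sibling descents: indices `2 ≤ i ≤ M` such that both `i-1` and `i`
are sibling descents and `i-1` is of type I. -/
noncomputable def dsdN (w : List ℕ) : ℕ :=
  ((Finset.Icc 2 w.length).filter fun i =>
    SDes w (i - 1) ∧ SDes w i ∧ TypeI w (i - 1)).card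

/-- linear descents -/
def dd : List ℕ → ℕ
  | [] => 0
  | [_] => 0
  | x :: y :: l => (if y < x then 1 else 0) + dd (y :: l)

/-- cyclic descents -/
def cd : List ℕ → ℕ
  | [] => 0
  | x :: u => dd (x :: u ++ [x])

lemma dd_append (A : List ℕ) (x : ℕ) (B : List ℕ) :
    dd (A ++ x :: B) = dd (A ++ [x]) + dd (x :: B) := by
  induction A with
  | nil => simp [dd]
  | cons a A ih =>
    cases A with
    | nil => cases B <;> simp [dd]
    | cons b A =>
      simp only [List.cons_append, dd] at ih ⊢
      omega

lemma cd_rotate1 (x : ℕ) (u : List ℕ) : cd (u ++ [x]) = cd (x :: u) := by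
  cases u with
  | nil => rfl
  | cons y u =>
    simp only [cd, List.cons_append, dd]
    have := dd_append (y :: u) x [y]
    simp only [List.cons_append, List.append_assoc, dd, List.nil_append] at this ⊢
    omega

lemma cd_rotate (w : List ℕ) (p : ℕ) : cd (w.rotate p) = cd w := by
  induction p generalizing w with
  | zero => simp
  | succ p ih =>
    cases w with
    | nil => simp
    | cons x u => rw [List.rotate_cons_succ, ih, cd_rotate1]

lemma dd_snoc_top (S : List ℕ) (N : ℕ) (h : ∀ x ∈ S, x ≤ N) : dd (S ++ [N]) = dd S := by
  induction S with
  | nil => rfl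
  | cons a S ih =>
    cases S with
    | nil => have := h a (by simp); simp [dd]; omega
    | cons b S =>
      have := ih (fun x hx => h x (List.mem_cons_of_mem _ hx))
      simp only [List.cons_append, dd] at this ⊢; omega

lemma dd_snoc_bot (S : List ℕ) (hS : S ≠ []) (h : ∀ x ∈ S, 0 < x) :
    dd (S ++ [0]) = dd S + 1 := by
  induction S with
  | nil => simp at hS
  | cons a S ih =>
    cases S with
    | nil => have := h a (by simp); simp [dd]; omega
    | cons b S =>
      have := ih (by simp) (fun x hx => h x (List.mem_cons_of_mem _ hx))
      simp only [List.cons_append, dd] at this ⊢; omega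

lemma dd_top (S : List ℕ) (N : ℕ) (hS : S ≠ []) (h : ∀ x ∈ S, x < N) :
    dd (N :: (S ++ [N])) = 1 + dd S := by
  cases S with
  | nil => simp at hS
  | cons a S =>
    have h1 := h a (by simp)
    have := dd_snoc_top (a :: S) N (fun x hx => (h x hx).le)
    simp only [List.cons_append, dd, h1, if_true] at this ⊢; omega

lemma dd_bot (S : List ℕ) (hS : S ≠ []) (h : ∀ x ∈ S, 0 < x) :
    dd (0 :: (S ++ [0])) = 1 + dd S := by
  have h2 := dd_snoc_bot S hS h
  cases S with
  | nil => simp at hS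
  | cons a S =>
    simp only [List.cons_append, dd] at h2 ⊢; simp; omega

lemma dd_loop (S : List ℕ) (N : ℕ) (h : ∀ x ∈ S, x < N) (h0 : ∀ x ∈ S, 0 < x) :
    dd (N :: (S ++ [N])) = dd (0 :: (S ++ [0])) := by
  by_cases hS : S = []
  · subst hS; simp [dd]
  · rw [dd_top S N hS h, dd_bot S hS h0]

lemma dd_transfer (u P S v : List ℕ) (N : ℕ) (h : ∀ x ∈ S, x < N) (h0 : ∀ x ∈ S, 0 < x) :
    dd (u ++ 0 :: (P ++ N :: (S ++ N :: v))) = dd (u ++ 0 :: (S ++ 0 :: (P ++ N :: v))) := by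
  have e := dd_loop S N h h0
  have a1 := dd_append u 0 (P ++ N :: (S ++ N :: v))
  have a2 := dd_append (0 :: P) N (S ++ N :: v)
  have a3 := dd_append (N :: S) N v
  have b1 := dd_append u 0 (S ++ 0 :: (P ++ N :: v))
  have b2 := dd_append (0 :: S) 0 (P ++ N :: v)
  have b3 := dd_append (0 :: P) N v
  simp only [List.cons_append] at *
  omega

lemma dd_eq_card (l : List ℕ) :
    dd l = ((Finset.range (l.length - 1)).filter fun i => l.getD (i + 1) 0 < l.getD i 0).card := by
  induction l with
  | nil => rfl
  | cons a l ih =>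
    cases l with
    | nil => rfl
    | cons b l =>
      rw [dd, ih, Finset.card_filter, Finset.card_filter]
      simp only [List.length_cons, Nat.add_sub_cancel]
      rw [Finset.sum_range_succ' _ l.length, add_comm]
      simp

lemma desN_eq (w : List ℕ) : desN w = dd (0 :: (w ++ [0])) := by
  rw [dd_eq_card]; simp [desN, pad]

lemma desN_cd (w : List ℕ) : desN w = cd (0 :: w) := by
  rw [desN_eq]; rfl

/-- quasi-Stirling, in terms of sublists -/
def QSs (w : List ℕ) : Prop := ∀ x y, x ≠ y → ¬ List.Sublist [x, y, x, y] w

lemma isQS_iff (w : List ℕ) : IsQS w ↔ QSs w := by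
  constructor
  · intro h x y hxy hs
    obtain ⟨is, he, hp⟩ := List.sublist_eq_map_getElem hs
    apply h
    obtain ⟨i, j, k, l, rfl⟩ : ∃ i j k l, is = [i, j, k, l] := by
      clear hp
      rcases is with _ | ⟨i, _ | ⟨j, _ | ⟨k, _ | ⟨l, _ | _⟩⟩⟩⟩ <;> simp at he ⊢
    · simp at he hp
      refine ⟨i, j, k, l, by omega, by omega, by omega, l.2, ?_, ?_, ?_⟩ <;>
        simp <;> grind
  · rintro h ⟨i, j, k, l, hij, hjk, hkl, hl, h1, h2, h3⟩
    apply h _ _ h3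
    have := List.map_getElem_sublist (l := w)
      (is := [⟨i, by omega⟩, ⟨j, by omega⟩, ⟨k, by omega⟩, ⟨l, hl⟩]) (by simp; omega)
    rw [List.getD_eq_getElem _ _ (by omega), List.getD_eq_getElem _ _ (by omega)] at *
    simp at this
    convert this using 3
    grind

lemma QSs.mono {w w' : List ℕ} (h : QSs w) (hs : List.Sublist w' w) : QSs w' :=
  fun x y hxy hh => h x y hxy (hh.trans hs)

lemma sublist_strip (X T l : List ℕ) (x : ℕ) (hx : x ∉ X) (h : List.Sublist (x :: l) (X ++ T)) :
    List.Sublist (x :: l) T := by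
  induction X with
  | nil => simpa using h
  | cons a X ih =>
    simp at hx
    apply ih hx.2
    cases h with
    | cons _ h => exact h
    | cons_cons _ h => simp at hx

lemma no_xyx (X S Y : List ℕ) (x y : ℕ) (hX : x ∉ X) (hY : x ∉ Y) (hy : y ∉ S) :
    ¬ List.Sublist [x, y, x] (X ++ (S ++ Y)) := by
  intro h
  have h1 := sublist_strip _ _ _ _ hX h
  have h2 := h1.reverse
  simp only [List.reverse_append] at h2
  have h3 := sublist_strip Y.reverse S.reverse [y, x] x (by simpa using hY) (by simpa using h2)
  have : y ∈ S.reverse := h3.subset (by simp)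
  simp at this
  exact hy this

lemma QSs_insert (X S Y : List ℕ) (hd : ∀ x ∈ S, x ∉ X ∧ x ∉ Y) :
    QSs (X ++ (S ++ Y)) ↔ QSs (X ++ Y) ∧ QSs S := by
  constructor
  · intro h
    exact ⟨h.mono (by simp), h.mono (by
      exact (List.sublist_append_left S Y).trans (List.sublist_append_right X _))⟩
  · rintro ⟨h1, h2⟩ x y hxy hs
    by_cases hx : x ∈ S <;> by_cases hy : y ∈ S
    · have := hs.filter (fun z => decide (z ∈ S))
      have e1 : X.filter (fun z => decide (z ∈ S)) = [] := by
        simp only [List.filter_eq_nil_iff]; intro a ha; simp; intro h; exact (hd a h).1 ha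
      have e2 : Y.filter (fun z => decide (z ∈ S)) = [] := by
        simp only [List.filter_eq_nil_iff]; intro a ha; simp; intro h; exact (hd a h).2 ha
      have e3 : S.filter (fun z => decide (z ∈ S)) = S := by
        simp only [List.filter_eq_self]; simp
      rw [List.filter_append, List.filter_append, e1, e2, e3] at this
      simp [hx, hy] at this
      exact h2 x y hxy this
    · exact no_xyx X S Y x y (hd x hx).1 (hd x hx).2 hy
        (List.Sublist.trans (by simp) hs)
    · exact no_xyx X S Y y x (hd y hy).1 (hd y hy).2 hx
        (List.Sublist.trans (by simp) hs)
    · have := hs.filter (fun z => decide (z ∉ S))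
      have e1 : X.filter (fun z => decide (z ∉ S)) = X := by
        simp only [List.filter_eq_self]; intro a ha; simp; intro h; exact (hd a h).1 ha
      have e2 : Y.filter (fun z => decide (z ∉ S)) = Y := by
        simp only [List.filter_eq_self]; intro a ha; simp; intro h; exact (hd a h).2 ha
      have e3 : S.filter (fun z => decide (z ∉ S)) = [] := by
        simp only [List.filter_eq_nil_iff]; simp
      rw [List.filter_append, List.filter_append, e1, e2, e3] at this
      simp [hx, hy] at this
      exact h1 x y hxy this

lemma sublist_dup (l Y : List ℕ) (j : ℕ) (hl : l.IsChain (· ≠ ·))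
    (h : List.Sublist l (j :: j :: Y)) : List.Sublist l (j :: Y) := by
  cases h with
  | cons _ h => exact h
  | cons_cons _ h =>
    cases h with
    | cons _ h => exact h.cons_cons _
    | cons_cons _ h => simp at hl

lemma QSs_dup (X Y : List ℕ) (j : ℕ) : QSs (X ++ j :: j :: Y) ↔ QSs (X ++ j :: Y) := by
  constructor
  · intro h; exact h.mono (by simp)
  · intro h x y hxy hs
    apply h x y hxy
    obtain ⟨l1, l2, he, h1, h2⟩ := List.sublist_append_iff.1 hs
    rw [he]
    refine h1.append (sublist_dup _ _ _ ?_ h2)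
    have : List.IsChain (· ≠ ·) [x, y, x, y] := by simp [hxy, hxy.symm]
    rw [he] at this
    exact this.right_of_append

lemma QSs_rotate1 (x : ℕ) (u : List ℕ) (h : QSs (x :: u)) : QSs (u ++ [x]) := by
  intro a b hab hs
  have h2 := hs.reverse
  simp only [List.reverse_append, List.reverse_cons, List.reverse_nil, List.nil_append,
    List.cons_append] at h2
  cases h2 with
  | cons _ h2 =>
    have := h2.reverse
    simp at this
    exact h a b hab (this.cons _)
  | cons_cons _ h2 =>
    have := h2.reverse
    simp at this
    exact h x a hab.symm (this.cons_cons _)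

lemma QSs_rotate (w : List ℕ) (p : ℕ) (h : QSs w) : QSs (w.rotate p) := by
  induction p generalizing w with
  | zero => simpa
  | succ p ih =>
    cases w with
    | nil => simpa
    | cons x u => rw [List.rotate_cons_succ]; exact ih _ (QSs_rotate1 x u h)

lemma sub4 (a b c d : ℕ) (A B C D E : List ℕ) :
    List.Sublist [a, b, c, d] (A ++ a :: (B ++ b :: (C ++ c :: (D ++ d :: E)))) := by
  have s : ∀ (x : ℕ) (A l T : List ℕ), List.Sublist l T → List.Sublist (x :: l) (A ++ x :: T) :=
    fun x A l T h => (h.cons_cons x).trans (List.sublist_append_right A _)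
  exact s _ _ _ _ (s _ _ _ _ (s _ _ _ _ (s _ _ _ _ (List.nil_sublist _))))

lemma QSs_transfer (u P S v : List ℕ) (N : ℕ) (hS0 : 0 ∉ S) (hSN : N ∉ S) :
    QSs (u ++ 0 :: (P ++ N :: (S ++ N :: v))) ↔ QSs (u ++ 0 :: (S ++ 0 :: (P ++ N :: v))) := by
  have key1 : QSs (u ++ 0 :: (P ++ N :: (S ++ N :: v))) →
      ∀ x ∈ S, x ∉ u ++ 0 :: (P ++ [N]) ∧ x ∉ N :: v := by
    intro h x hx
    have hx0 : x ≠ 0 := fun e => hS0 (e ▸ hx)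
    have hxN : x ≠ N := fun e => hSN (e ▸ hx)
    obtain ⟨S1, S2, rfl⟩ := List.append_of_mem hx
    constructor
    · intro hm
      simp [hx0, hxN] at hm
      rcases hm with hm | hm
      · obtain ⟨A, B, rfl⟩ := List.append_of_mem hm
        apply h x N hxN
        have := sub4 x N x N A (B ++ 0 :: P) S1 S2 v
        simpa using this
      · obtain ⟨A, B, rfl⟩ := List.append_of_mem hm
        apply h x N hxN
        have := sub4 x N x N (u ++ 0 :: A) B S1 S2 v
        simpa using this
    · intro hm
      simp [hxN] at hm
      obtain ⟨A, B, rfl⟩ := List.append_of_mem hm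
      apply h N x hxN.symm
      have := sub4 N x N x (u ++ 0 :: P) S1 S2 A B
      simpa using this
  have key2 : QSs (u ++ 0 :: (S ++ 0 :: (P ++ N :: v))) →
      ∀ x ∈ S, x ∉ u ++ 0 :: (P ++ [N]) ∧ x ∉ N :: v := by
    intro h x hx
    have hx0 : x ≠ 0 := fun e => hS0 (e ▸ hx)
    have hxN : x ≠ N := fun e => hSN (e ▸ hx)
    obtain ⟨S1, S2, rfl⟩ := List.append_of_mem hx
    constructor
    · intro hm
      simp [hx0, hxN] at hm
      rcases hm with hm | hm
      · obtain ⟨A, B, rfl⟩ := List.append_of_mem hm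
        apply h x 0 hx0
        have := sub4 x 0 x 0 A B S1 S2 (P ++ N :: v)
        simpa using this
      · obtain ⟨A, B, rfl⟩ := List.append_of_mem hm
        apply h 0 x hx0.symm
        have := sub4 0 x 0 x u S1 S2 A (B ++ N :: v)
        simpa using this
    · intro hm
      simp [hxN] at hm
      obtain ⟨A, B, rfl⟩ := List.append_of_mem hm
      apply h 0 x hx0.symm
      have := sub4 0 x 0 x u S1 S2 (P ++ N :: A) B
      simpa using this
  by_cases hd : ∀ x ∈ S, x ∉ u ++ 0 :: (P ++ [N]) ∧ x ∉ N :: v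
  · have e1 := QSs_insert (u ++ 0 :: (P ++ [N])) S (N :: v) hd
    have e2 := QSs_insert (u ++ [0]) S (0 :: (P ++ N :: v)) (by
      intro x hx
      have := hd x hx
      simp at this ⊢
      tauto)
    have d1 := QSs_dup (u ++ 0 :: P) v N
    have d2 := QSs_dup u (P ++ N :: v) 0
    simp only [List.append_assoc, List.cons_append, List.nil_append] at *
    rw [e1, e2, d1, d2]
  · exact ⟨fun h => absurd (key1 h) hd, fun h => absurd (key2 h) hd⟩

/-- sorted list of the multiset `{0^{m 0}, …, n^{m n}}` -/
def baseL (n : ℕ) (m : ℕ → ℕ) : List ℕ := List.replicate (m 0) 0 ++ msetList n m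

lemma msetList_succ (n : ℕ) (m : ℕ → ℕ) :
    msetList (n + 1) m = msetList n m ++ List.replicate (m (n + 1)) (n + 1) := by
  simp [msetList, List.range_succ]

lemma count_baseL (n : ℕ) (m : ℕ → ℕ) (x : ℕ) :
    (baseL n m).count x = if x ≤ n then m x else 0 := by
  induction n with
  | zero =>
    simp [baseL, msetList, List.count_replicate]
    grind
  | succ n ih =>
    simp only [baseL, msetList_succ, List.count_append, List.count_replicate] at ih ⊢
    grind

lemma length_msetList (n : ℕ) (m : ℕ → ℕ) :
    (msetList n m).length = ∑ i ∈ Finset.range n, m (i + 1) := by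
  induction n with
  | zero => simp [msetList]
  | succ n ih => rw [msetList_succ, Finset.sum_range_succ]; simp [ih]

lemma length_baseL (n : ℕ) (m : ℕ → ℕ) :
    (baseL n m).length = ∑ i ∈ Finset.range (n + 1), m i := by
  rw [Finset.sum_range_succ', add_comm, baseL, List.length_append, length_msetList]; simp

/-- all linear quasi-Stirling words on the multiset `{0^{m 0}, …, n^{m n}}` -/
noncomputable def Rset (n : ℕ) (m : ℕ → ℕ) : Finset (List ℕ) :=
  (baseL n m).permutations.toFinset.filter QSs

lemma mem_Rset {n : ℕ} {m : ℕ → ℕ} {w : List ℕ} :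
    w ∈ Rset n m ↔ (∀ x, w.count x = if x ≤ n then m x else 0) ∧ QSs w := by
  simp only [Rset, Finset.mem_filter, List.mem_toFinset, List.mem_permutations,
    List.perm_iff_count, count_baseL]

lemma length_of_mem {n : ℕ} {m : ℕ → ℕ} {w : List ℕ} (h : w ∈ Rset n m) :
    w.length = ∑ i ∈ Finset.range (n + 1), m i := by
  simp only [Rset, Finset.mem_filter, List.mem_toFinset, List.mem_permutations] at h
  rw [h.1.length_eq, length_baseL]

lemma le_of_mem {n : ℕ} {m : ℕ → ℕ} {w : List ℕ} (h : w ∈ Rset n m) {x : ℕ} (hx : x ∈ w) :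
    x ≤ n := by
  have := (mem_Rset.1 h).1 x
  have h2 := List.count_pos_iff.2 hx
  by_contra hc
  rw [if_neg hc] at this
  omega

lemma rotate_mem {n : ℕ} {m : ℕ → ℕ} {w : List ℕ} (h : w ∈ Rset n m) (p : ℕ) :
    w.rotate p ∈ Rset n m := by
  rw [mem_Rset] at h ⊢
  refine ⟨fun x => ?_, QSs_rotate _ _ h.2⟩
  rw [(List.rotate_perm w p).count_eq, h.1]

lemma rotSum (n : ℕ) (m : ℕ → ℕ) (L : ℕ) (hL : L = ∑ i ∈ Finset.range (n + 1), m i)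
    (F : List ℕ → PowerSeries ℚ) :
    ∑ w ∈ Rset n m, ∑ p ∈ Finset.range L, F (w.rotate p) = (L : PowerSeries ℚ) * ∑ w ∈ Rset n m, F w := by
  rw [Finset.sum_comm]
  have : ∀ p ∈ Finset.range L, ∑ w ∈ Rset n m, F (w.rotate p) = ∑ w ∈ Rset n m, F w := by
    intro p hp
    have hp := Finset.mem_range.1 hp
    refine Finset.sum_nbij' (fun w => w.rotate p) (fun w => w.rotate (L - p))
      (fun w hw => rotate_mem hw p) (fun w hw => rotate_mem hw _) ?_ ?_ (fun _ _ => rfl)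
    · intro w hw
      rw [List.rotate_rotate, Nat.add_sub_cancel' hp.le, hL, ← length_of_mem hw, List.rotate_length]
    · intro w hw
      rw [List.rotate_rotate, Nat.sub_add_cancel hp.le, hL, ← length_of_mem hw, List.rotate_length]
  rw [Finset.sum_congr rfl this]
  simp

lemma sum_getElem_count (w : List ℕ) (x : ℕ) :
    ∑ p ∈ Finset.range w.length, (if w[p]? = some x then (1 : PowerSeries ℚ) else 0) = w.count x := by
  induction w with
  | nil => simp
  | cons a w ih =>
    rw [List.length_cons, Finset.sum_range_succ', List.count_cons]
    simp only [List.getElem?_cons_succ, ih]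
    by_cases h : a = x <;> simp [h]

lemma sum_head_count (w : List ℕ) (x : ℕ) :
    ∑ p ∈ Finset.range w.length, (if (w.rotate p).head? = some x then (1 : PowerSeries ℚ) else 0)
      = w.count x := by
  rw [← sum_getElem_count]
  refine Finset.sum_congr rfl fun p hp => ?_
  rw [List.head?_rotate (Finset.mem_range.1 hp)]

/-- descent enumerator -/
noncomputable def Wgf (n : ℕ) (m : ℕ → ℕ) : PowerSeries ℚ :=
  ∑ w ∈ Rset n m, (PowerSeries.X : PowerSeries ℚ) ^ cd w

lemma Wgf_head (n : ℕ) (m : ℕ → ℕ) (L : ℕ) (hL : L = ∑ i ∈ Finset.range (n + 1), m i)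
    (x : ℕ) (hx : x ≤ n) (hm : m x = 1) :
    Wgf n m = (L : PowerSeries ℚ) *
      ∑ w ∈ (Rset n m).filter (fun w => w.head? = some x), (PowerSeries.X : PowerSeries ℚ) ^ cd w := by
  rw [Finset.sum_filter, ← rotSum n m L hL, Wgf]
  refine Finset.sum_congr rfl fun w hw => ?_
  simp only [cd_rotate]
  have := sum_head_count w x
  rw [(mem_Rset.1 hw).1 x, if_pos hx, hm] at this
  rw [length_of_mem hw, ← hL] at this
  calc _ = (∑ p ∈ Finset.range L, (if (w.rotate p).head? = some x then (1 : PowerSeries ℚ) else 0)) * PowerSeries.X ^ cd w := by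
        rw [this]; simp
    _ = _ := by
        rw [Finset.sum_mul]
        refine Finset.sum_congr rfl fun p _ => ?_
        split_ifs <;> simp

lemma cd_close (x y : ℕ) (T : List ℕ) :
    cd (y :: (T ++ [x])) = dd (y :: (T ++ [x])) + if y < x then 1 else 0 := by
  have := dd_append (y :: T) x [y]
  simp only [cd, dd, List.cons_append, List.append_assoc, List.nil_append] at this ⊢
  omega

lemma rot_step (u : List ℕ) (p : ℕ) (hp : p + 1 < u.length) :
    (if dd (u.rotate (p + 1)) < cd u then 1 else 0) =
      if u.getD (p + 1) 0 < u.getD p 0 then 1 else 0 := by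
  have e2 : u.rotate (p + 1) = u[p+1] :: ((u.drop (p + 2) ++ u.take p) ++ [u[p]]) := by
    rw [List.rotate_eq_drop_append_take (by omega), List.drop_eq_getElem_cons hp,
      List.take_add_one, List.getElem?_eq_getElem (show p < u.length by omega)]
    simp only [List.cons_append, List.append_assoc, Option.toList_some]
  have h := cd_close u[p] u[p+1] (u.drop (p + 2) ++ u.take p)
  rw [← e2, cd_rotate] at h
  rw [List.getD_eq_getElem _ _ hp, List.getD_eq_getElem _ _ (by omega)]
  split_ifs at * <;> omega

lemma cd_le (u : List ℕ) : cd u = dd u + if dd u < cd u then 1 else 0 := by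
  rcases u with _ | ⟨y, T⟩
  · rfl
  · rcases List.eq_nil_or_concat T with rfl | ⟨T', x, rfl⟩
    · simp [cd, dd]
    · have := cd_close x y T'
      simp only [List.concat_eq_append]
      split_ifs at * <;> omega

lemma sum_rot_cd (u : List ℕ) :
    ∑ p ∈ Finset.range u.length, (if dd (u.rotate p) < cd u then 1 else 0) = cd u := by
  rcases u with _ | ⟨y, T⟩
  · rfl
  · rw [List.length_cons, Finset.sum_range_succ']
    have h := cd_le (y :: T)
    have h2 := dd_eq_card (y :: T)
    rw [Finset.card_filter] at h2
    simp only [List.length_cons, Nat.add_sub_cancel] at h2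
    rw [Finset.sum_congr rfl (fun p hp => rot_step (y :: T) p
      (by simpa using Finset.mem_range.1 hp)), ← h2]
    simp only [List.rotate_zero]
    exact h.symm

lemma sum_rot_X (u : List ℕ) :
    ∑ p ∈ Finset.range u.length, (PowerSeries.X : PowerSeries ℚ) ^ (1 + dd (u.rotate p)) =
      (cd u : PowerSeries ℚ) * PowerSeries.X ^ cd u +
        ((u.length : PowerSeries ℚ) - (cd u : PowerSeries ℚ)) * PowerSeries.X ^ (cd u + 1) := by
  have h : ∀ p ∈ Finset.range u.length, (PowerSeries.X : PowerSeries ℚ) ^ (1 + dd (u.rotate p)) =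
      ((if dd (u.rotate p) < cd u then 1 else 0 : ℕ) : PowerSeries ℚ) *
        (PowerSeries.X ^ cd u - PowerSeries.X ^ (cd u + 1)) + PowerSeries.X ^ (cd u + 1) := by
    intro p _
    have := cd_le (u.rotate p)
    rw [cd_rotate] at this
    split_ifs at * with hc
    · rw [this]; simp [add_comm]
    · rw [this]; simp [add_comm]
  rw [Finset.sum_congr rfl h, Finset.sum_add_distrib, ← Finset.sum_mul, ← Nat.cast_sum, sum_rot_cd]
  simp
  ring

/-- canonical rotations: start with `0`, and all `0`s precede all `N`s -/
def Hp (N : ℕ) (w : List ℕ) : Prop := w.head? = some 0 ∧ ¬ List.Sublist [N, 0] w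

lemma sub2 (a b : ℕ) (X Y : List ℕ) (ha : a ∈ X) (hb : b ∈ Y) : List.Sublist [a, b] (X ++ Y) :=
  (List.singleton_sublist.2 ha).append (List.singleton_sublist.2 hb)

lemma Hp_unique (N : ℕ) (w : List ℕ) (hw : Hp N w) (hN : N ∈ w) (p : ℕ) (hp : 0 < p)
    (hp2 : p < w.length) : ¬ Hp N (w.rotate p) := by
  intro h
  rw [List.rotate_eq_drop_append_take hp2.le] at h
  have e := List.take_append_drop p w
  have h1 : 0 ∈ w.take p := by
    rcases w with _ | ⟨a, w⟩
    · simp at hN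
    · have := hw.1; simp at this; subst this
      cases p with
      | zero => omega
      | succ p => simp
  have h2 : 0 ∈ w.drop p := by
    have := h.1
    rw [List.head?_append, List.head?_drop, List.getElem?_eq_getElem hp2] at this
    simp at this
    rw [List.drop_eq_getElem_cons hp2, this]; simp
  rw [← e, List.mem_append] at hN
  rcases hN with hN | hN
  · apply hw.2; rw [← e]; exact sub2 _ _ _ _ hN h2
  · exact h.2 (sub2 _ _ _ _ hN h1)

lemma sub2_append_iff (a b : ℕ) (X Y : List ℕ) : List.Sublist [a, b] (X ++ Y) ↔
    List.Sublist [a, b] X ∨ List.Sublist [a, b] Y ∨ (a ∈ X ∧ b ∈ Y) := by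
  constructor
  · intro h
    obtain ⟨l1, l2, he, h1, h2⟩ := List.sublist_append_iff.1 h
    rcases l1 with _ | ⟨c, _ | ⟨d, l1⟩⟩
    · simp at he; subst he; tauto
    · simp at he; obtain ⟨rfl, rfl⟩ := he
      right; right; exact ⟨by simpa using h1, by simpa using h2⟩
    · simp at he; obtain ⟨rfl, rfl, rfl, rfl⟩ := he; tauto
  · rintro (h | h | h)
    · exact h.trans (List.sublist_append_left _ _)
    · exact h.trans (List.sublist_append_right _ _)
    · exact sub2 _ _ _ _ h.1 h.2

lemma split_last (x : ℕ) (A : List ℕ) (h : x ∈ A) : ∃ A1 A2, A = A1 ++ x :: A2 ∧ x ∉ A2 := by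
  obtain ⟨B1, B2, hB, hn⟩ := List.eq_append_cons_of_mem (List.mem_reverse.2 h)
  refine ⟨B2.reverse, B1.reverse, ?_, by simpa using hn⟩
  have := congrArg List.reverse hB
  simpa using this

lemma Hp_exists (N : ℕ) (hN0 : N ≠ 0) (w : List ℕ) (hq : QSs w) (h0 : 0 ∈ w) (hN : N ∈ w) :
    ∃ p < w.length, Hp N (w.rotate p) := by
  suffices ∃ v, w ~r v ∧ Hp N v by
    obtain ⟨v, ⟨k, rfl⟩, h⟩ := this
    have : 0 < w.length := List.length_pos_of_mem h0
    exact ⟨k % w.length, Nat.mod_lt _ this, by rwa [List.rotate_mod]⟩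
  obtain ⟨Y, Z, rfl⟩ := List.append_of_mem h0
  have r1 : (Y ++ 0 :: Z) ~r (0 :: Z ++ Y) := List.isRotated_append
  have q1 : QSs (0 :: (Z ++ Y)) := by
    obtain ⟨k, hk⟩ := r1
    have := QSs_rotate _ k hq
    rw [hk] at this
    simpa using this
  have n1 : N ∈ Z ++ Y := by simp [hN0] at hN ⊢; tauto
  obtain ⟨A1, A2, hA, hA2⟩ := split_last _ _ n1
  have hA1 : ¬ List.Sublist [N, 0] A1 := by
    intro hs
    apply q1 0 N hN0.symm
    rw [hA]
    have := hs.append (show List.Sublist [N] (N :: A2) by simp)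
    exact this.cons_cons 0
  by_cases hz : 0 ∈ A2
  · obtain ⟨C, D, hC, hn⟩ := List.eq_append_cons_of_mem hz
    refine ⟨(0 :: D) ++ (0 :: A1 ++ N :: C), r1.trans ?_, ?_⟩
    · have : (0 :: Z ++ Y) = (0 :: A1 ++ N :: C) ++ (0 :: D) := by
        simp [hA, hC]
      rw [this]; exact List.isRotated_append
    · refine ⟨by simp, ?_⟩
      have e : (0 :: D) ++ (0 :: A1 ++ N :: C) = ([0] ++ D) ++ (([0] ++ A1) ++ ([N] ++ C)) := by simp
      rw [e]
      simp only [sub2_append_iff, not_or]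
      have hD : N ∉ D := by simp [hC] at hA2; tauto
      have hC' : N ∉ C := by simp [hC] at hA2; tauto
      have hDs : ¬ List.Sublist [N, 0] D := fun h => hD (h.subset (by simp))
      have hCs : ¬ List.Sublist [N, 0] C := fun h => hC' (h.subset (by simp))
      simp [hN0, hN0.symm, hD, hn, hDs, hCs, hA1]
  · refine ⟨0 :: A1 ++ N :: A2, by simpa [hA] using r1, by simp, ?_⟩
    have e : (0 :: A1 ++ N :: A2) = (([0] ++ A1) ++ ([N] ++ A2)) := by simp
    rw [e]
    have hCs : ¬ List.Sublist [N, 0] A2 := fun h => hA2 (h.subset (by simp))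
    simp only [sub2_append_iff, not_or]
    simp [hN0, hN0.symm, hz, hCs, hA1]

lemma Hp_sum (N : ℕ) (hN0 : N ≠ 0) (w : List ℕ) (hq : QSs w) (h0 : 0 ∈ w) (hN : N ∈ w) :
    ∑ p ∈ Finset.range w.length, (if Hp N (w.rotate p) then (1 : PowerSeries ℚ) else 0) = 1 := by
  obtain ⟨p, hp, h⟩ := Hp_exists N hN0 w hq h0 hN
  have key : ∀ a b, a < b → b < w.length → Hp N (w.rotate a) → ¬ Hp N (w.rotate b) := by
    intro a b hab hb ha
    have := Hp_unique N (w.rotate a) ha (by simpa using hN) (b - a) (by omega) (by simp; omega)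
    rwa [List.rotate_rotate, Nat.add_sub_cancel' hab.le] at this
  rw [Finset.sum_eq_single_of_mem p (Finset.mem_range.2 hp)]
  · simp [h]
  · intro q hq hne
    have hq := Finset.mem_range.1 hq
    rw [if_neg]
    intro h'
    rcases lt_or_gt_of_ne hne with hl | hl
    · exact key q p hl hp h' h
    · exact key p q hl hq h h'

lemma Wgf_Hp (n : ℕ) (m : ℕ → ℕ) (L : ℕ) (hL : L = ∑ i ∈ Finset.range (n + 1), m i)
    (hn : n ≠ 0) (h0 : 1 ≤ m 0) (h1 : 1 ≤ m n) :
    Wgf n m = (L : PowerSeries ℚ) *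
      ∑ w ∈ (Rset n m).filter (Hp n), (PowerSeries.X : PowerSeries ℚ) ^ cd w := by
  rw [Finset.sum_filter, ← rotSum n m L hL, Wgf]
  refine Finset.sum_congr rfl fun w hw => ?_
  simp only [cd_rotate]
  have hm := mem_Rset.1 hw
  have := Hp_sum n hn w hm.2 (List.count_pos_iff.1 (by rw [hm.1]; simp; omega))
    (List.count_pos_iff.1 (by rw [hm.1]; simp; omega))
  rw [length_of_mem hw, ← hL] at this
  calc _ = (∑ p ∈ Finset.range L, (if Hp n (w.rotate p) then (1 : PowerSeries ℚ) else 0)) * PowerSeries.X ^ cd w := by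
        rw [this]; simp
    _ = _ := by
        rw [Finset.sum_mul]
        refine Finset.sum_congr rfl fun p _ => ?_
        split_ifs <;> simp

lemma sum_rel {α β M : Type*} [AddCommMonoid M] (s : Finset α) (t : Finset β) (f : α → M) (g : β → M)
    (r : α → β → Prop) (h1 : ∀ a ∈ s, ∃ b ∈ t, r a b) (h2 : ∀ b ∈ t, ∃ a ∈ s, r a b)
    (u1 : ∀ a b b', r a b → r a b' → b = b') (u2 : ∀ a a' b, r a b → r a' b → a = a')
    (hf : ∀ a ∈ s, ∀ b, r a b → f a = g b) : ∑ a ∈ s, f a = ∑ b ∈ t, g b := by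
  choose i hi hr using h1
  refine Finset.sum_bij i hi ?_ ?_ ?_
  · intro a ha a' ha' e
    exact u2 a a' (i a ha) (hr a ha) (e ▸ hr a' ha')
  · intro b hb
    obtain ⟨a, ha, hab⟩ := h2 b hb
    exact ⟨a, ha, u1 a _ _ (hr a ha) hab⟩
  · intro a ha
    exact hf a ha _ (hr a ha)

/-- move one copy from `n` to `0` -/
def shiftM (n : ℕ) (m : ℕ → ℕ) : ℕ → ℕ :=
  fun x => if x = 0 then m 0 + 1 else if x = n then m n - 1 else m x

/-- admissible decomposition data -/
def Dec (n : ℕ) (u P S v : List ℕ) : Prop :=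
  n ∉ u ∧ 0 ∉ P ∧ n ∉ P ∧ 0 ∉ S ∧ n ∉ S ∧ 0 ∉ v

/-- first word -/
def wA (n : ℕ) (u P S v : List ℕ) : List ℕ := u ++ 0 :: (P ++ n :: (S ++ n :: v))
/-- second word -/
def wB (n : ℕ) (u P S v : List ℕ) : List ℕ := u ++ 0 :: (S ++ 0 :: (P ++ n :: v))

lemma not_sub_left {a b : ℕ} {X : List ℕ} (h : a ∉ X) : ¬ List.Sublist [a, b] X :=
  fun hs => h (hs.subset (by simp))

lemma not_sub_right {a b : ℕ} {X : List ℕ} (h : b ∉ X) : ¬ List.Sublist [a, b] X :=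
  fun hs => h (hs.subset (by simp))

lemma not_subA {n : ℕ} (hn : n ≠ 0) {u P S v : List ℕ} (h : Dec n u P S v) :
    ¬ List.Sublist [n, 0] (wA n u P S v) := by
  obtain ⟨h1, h2, h3, h4, h5, h6⟩ := h
  have e : wA n u P S v = u ++ ([0] ++ (P ++ ([n] ++ (S ++ ([n] ++ v))))) := by simp [wA]
  rw [e]
  simp only [sub2_append_iff, not_or]
  simp [*, not_sub_left, not_sub_right, hn.symm]

lemma not_subB {n : ℕ} (hn : n ≠ 0) {u P S v : List ℕ} (h : Dec n u P S v) :
    ¬ List.Sublist [n, 0] (wB n u P S v) := by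
  obtain ⟨h1, h2, h3, h4, h5, h6⟩ := h
  have e : wB n u P S v = u ++ ([0] ++ (S ++ ([0] ++ (P ++ ([n] ++ v))))) := by simp [wB]
  rw [e]
  simp only [sub2_append_iff, not_or]
  simp [*, not_sub_left, not_sub_right, hn.symm]

lemma head_iff (u T T' : List ℕ) : (u ++ 0 :: T).head? = some 0 ↔ (u ++ 0 :: T').head? = some 0 := by
  cases u <;> simp

lemma wAB {n : ℕ} (hn : n ≠ 0) {m : ℕ → ℕ} (hmn : 2 ≤ m n) {u P S v : List ℕ} (h : Dec n u P S v) :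
    wA n u P S v ∈ (Rset n m).filter (Hp n) ↔ wB n u P S v ∈ (Rset n (shiftM n m)).filter (Hp n) := by
  rw [Finset.mem_filter, Finset.mem_filter, mem_Rset, mem_Rset, Hp, Hp]
  have hq : QSs (wA n u P S v) ↔ QSs (wB n u P S v) := QSs_transfer u P S v n h.2.2.2.1 h.2.2.2.2.1
  have hh : (wA n u P S v).head? = some 0 ↔ (wB n u P S v).head? = some 0 := head_iff _ _ _
  have hc : (∀ x, (wA n u P S v).count x = if x ≤ n then m x else 0) ↔
      (∀ x, (wB n u P S v).count x = if x ≤ n then shiftM n m x else 0) := by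
    refine forall_congr' fun x => ?_
    simp only [wA, wB, List.count_append, List.count_cons, shiftM, beq_iff_eq]
    by_cases hx : x = 0
    · subst hx; simp [hn]; omega
    · by_cases hx2 : x = n
      · subst hx2; simp [hn, hn.symm]; omega
      · have a1 : ¬ (0 = x) := fun e => hx e.symm
        have a2 : ¬ (n = x) := fun e => hx2 e.symm
        simp only [hx, hx2, a1, a2, if_false]
        constructor <;> intro h <;> omega
  have n1 := not_subA hn h
  have n2 := not_subB hn h
  tauto

lemma existsA {n : ℕ} (hn : n ≠ 0) {m : ℕ → ℕ} (hmn : 2 ≤ m n) {w : List ℕ}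
    (h : w ∈ (Rset n m).filter (Hp n)) : ∃ u P S v, Dec n u P S v ∧ w = wA n u P S v := by
  rw [Finset.mem_filter, mem_Rset] at h
  obtain ⟨⟨hc, -⟩, hh, hs⟩ := h
  have hcn := hc n
  simp only [le_refl, if_true] at hcn
  have h0 : 0 ∈ w := List.mem_of_mem_head? hh
  have hnw : n ∈ w := List.count_pos_iff.1 (by omega)
  obtain ⟨A, B, rfl, hA⟩ := List.eq_append_cons_of_mem hnw
  rw [sub2_append_iff] at hs
  have hB : 0 ∉ B := fun hb => hs (Or.inr (Or.inl (sub2 n 0 [n] B (by simp) hb)))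
  have h0A : 0 ∈ A := by simp [hB, hn.symm] at h0; exact h0
  obtain ⟨u, P, rfl, hP⟩ := split_last 0 A h0A
  have hnB : n ∈ B := by
    apply List.count_pos_iff.1
    rw [List.count_append, List.count_eq_zero_of_not_mem hA, List.count_cons_self] at hcn
    omega
  obtain ⟨S, v, rfl, hS⟩ := List.eq_append_cons_of_mem hnB
  refine ⟨u, P, S, v, ?_, by simp [wA]⟩
  simp at hA hB
  unfold Dec
  tauto

lemma existsB {n : ℕ} (hn : n ≠ 0) {m : ℕ → ℕ} (h0m : 1 ≤ m 0) (hmn : 2 ≤ m n) {w : List ℕ}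
    (h : w ∈ (Rset n (shiftM n m)).filter (Hp n)) : ∃ u P S v, Dec n u P S v ∧ w = wB n u P S v := by
  rw [Finset.mem_filter, mem_Rset] at h
  obtain ⟨⟨hc, -⟩, hh, hs⟩ := h
  have hcn := hc n
  have hc0 := hc 0
  simp only [le_refl, if_true, zero_le, shiftM, hn, if_false] at hcn hc0
  have hnw : n ∈ w := List.count_pos_iff.1 (by omega)
  obtain ⟨A, B, rfl, hA⟩ := List.eq_append_cons_of_mem hnw
  rw [sub2_append_iff] at hs
  have hB : 0 ∉ B := fun hb => hs (Or.inr (Or.inl (sub2 n 0 [n] B (by simp) hb)))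
  have h0A : 2 ≤ A.count 0 := by
    rw [List.count_append, List.count_cons_of_ne hn, List.count_eq_zero_of_not_mem hB] at hc0
    omega
  obtain ⟨A', P, rfl, hP⟩ := split_last 0 A (List.count_pos_iff.1 (by omega))
  have h0A' : 0 ∈ A' := by
    apply List.count_pos_iff.1
    rw [List.count_append, List.count_cons_self, List.count_eq_zero_of_not_mem hP] at h0A
    omega
  obtain ⟨u, S, rfl, hS⟩ := split_last 0 A' h0A'
  refine ⟨u, P, S, B, ?_, by simp [wB]⟩
  simp at hA
  unfold Dec
  tauto

lemma first_inj {x : ℕ} {A B A' B' : List ℕ} (h : x ∉ A) (h' : x ∉ A')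
    (e : A ++ x :: B = A' ++ x :: B') : A = A' ∧ B = B' := by
  induction A generalizing A' with
  | nil =>
    cases A' with
    | nil => simpa using e
    | cons a A' => simp at e h'; exact absurd e.1 h'.1
  | cons b A ih =>
    cases A' with
    | nil => simp at e h; exact absurd e.1.symm h.1
    | cons a A' =>
      simp only [List.cons_append, List.cons.injEq] at e
      simp only [List.mem_cons, not_or] at h h'
      have := ih h.2 h'.2 e.2
      rw [e.1, this.1]; exact ⟨rfl, this.2⟩

lemma last_inj {x : ℕ} {A B A' B' : List ℕ} (h : x ∉ B) (h' : x ∉ B')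
    (e : A ++ x :: B = A' ++ x :: B') : A = A' ∧ B = B' := by
  have e2 := congrArg List.reverse e
  simp only [List.reverse_append, List.reverse_cons, List.append_assoc, List.cons_append,
    List.nil_append] at e2
  have := first_inj (by simpa using h) (by simpa using h') e2
  simpa [and_comm] using this

lemma wA_inj {n : ℕ} (hn : n ≠ 0) {u P S v u' P' S' v' : List ℕ} (h : Dec n u P S v)
    (h' : Dec n u' P' S' v') (e : wA n u P S v = wA n u' P' S' v') :
    u = u' ∧ P = P' ∧ S = S' ∧ v = v' := by
  obtain ⟨h1, h2, h3, h4, h5, h6⟩ := h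
  obtain ⟨g1, g2, g3, g4, g5, g6⟩ := h'
  have e1 : (u ++ 0 :: P) ++ n :: (S ++ n :: v) = (u' ++ 0 :: P') ++ n :: (S' ++ n :: v') := by
    simpa [wA] using e
  obtain ⟨a, b⟩ := first_inj (by simp [*]) (by simp [*]) e1
  obtain ⟨c, d⟩ := first_inj h5 g5 b
  obtain ⟨c', d'⟩ := last_inj h2 g2 a
  exact ⟨c', d', c, d⟩

lemma wB_inj {n : ℕ} (hn : n ≠ 0) {u P S v u' P' S' v' : List ℕ} (h : Dec n u P S v)
    (h' : Dec n u' P' S' v') (e : wB n u P S v = wB n u' P' S' v') :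
    u = u' ∧ P = P' ∧ S = S' ∧ v = v' := by
  obtain ⟨h1, h2, h3, h4, h5, h6⟩ := h
  obtain ⟨g1, g2, g3, g4, g5, g6⟩ := h'
  have e1 : (u ++ 0 :: (S ++ 0 :: P)) ++ n :: v = (u' ++ 0 :: (S' ++ 0 :: P')) ++ n :: v' := by
    simpa [wB] using e
  obtain ⟨a, b⟩ := first_inj (by simp [*]) (by simp [*]) e1
  have a2 : (u ++ 0 :: S) ++ 0 :: P = (u' ++ 0 :: S') ++ 0 :: P' := by simpa using a
  obtain ⟨c, d⟩ := last_inj h2 g2 a2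
  obtain ⟨c', d'⟩ := last_inj h4 g4 c
  exact ⟨c', d, d', b⟩

lemma cd_of_head (w : List ℕ) (h : w.head? = some 0) : cd w = dd (w ++ [0]) := by
  cases w with
  | nil => simp at h
  | cons a w => simp at h; subst h; rfl

lemma Hp_transfer (n : ℕ) (hn : n ≠ 0) (m : ℕ → ℕ) (h0m : 1 ≤ m 0) (hmn : 2 ≤ m n) :
    ∑ w ∈ (Rset n m).filter (Hp n), (PowerSeries.X : PowerSeries ℚ) ^ cd w =
    ∑ w ∈ (Rset n (shiftM n m)).filter (Hp n), (PowerSeries.X : PowerSeries ℚ) ^ cd w := by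
  refine sum_rel _ _ _ _ (fun w w' => ∃ u P S v, Dec n u P S v ∧ w = wA n u P S v ∧
    w' = wB n u P S v) ?_ ?_ ?_ ?_ ?_
  · intro w hw
    obtain ⟨u, P, S, v, hD, rfl⟩ := existsA hn hmn hw
    exact ⟨_, (wAB hn hmn hD).1 hw, u, P, S, v, hD, rfl, rfl⟩
  · intro w hw
    obtain ⟨u, P, S, v, hD, rfl⟩ := existsB hn h0m hmn hw
    exact ⟨_, (wAB hn hmn hD).2 hw, u, P, S, v, hD, rfl, rfl⟩
  · rintro a b b' ⟨u, P, S, v, hD, rfl, rfl⟩ ⟨u', P', S', v', hD', e, rfl⟩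
    obtain ⟨rfl, rfl, rfl, rfl⟩ := wA_inj hn hD hD' e
    rfl
  · rintro a b b' ⟨u, P, S, v, hD, rfl, rfl⟩ ⟨u', P', S', v', hD', rfl, e⟩
    obtain ⟨rfl, rfl, rfl, rfl⟩ := wB_inj hn hD hD' e
    rfl
  · rintro w hw w' ⟨u, P, S, v, hD, rfl, rfl⟩
    have hw' := (wAB hn hmn hD).1 hw
    rw [Finset.mem_filter] at hw hw'
    rw [cd_of_head _ hw.2.1, cd_of_head _ hw'.2.1]
    have := dd_transfer u P S (v ++ [0]) n
      (fun x hx => lt_of_le_of_ne (le_of_mem hw.1 (by simp [wA, hx]))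
        (fun e => hD.2.2.2.2.1 (e ▸ hx)))
      (fun x hx => Nat.pos_of_ne_zero (fun e => hD.2.2.2.1 (e ▸ hx)))
    congr 1
    simpa [wA, wB] using this

lemma sum_shiftM (n : ℕ) (hn : n ≠ 0) (m : ℕ → ℕ) (hmn : 1 ≤ m n) :
    ∑ i ∈ Finset.range (n + 1), shiftM n m i = ∑ i ∈ Finset.range (n + 1), m i := by
  obtain ⟨k, rfl⟩ := Nat.exists_eq_succ_of_ne_zero hn
  rw [Finset.sum_range_succ, Finset.sum_range_succ', Finset.sum_range_succ _ (k + 1),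
    Finset.sum_range_succ' _ k]
  have : ∑ i ∈ Finset.range k, shiftM (k + 1) m (i + 1) = ∑ i ∈ Finset.range k, m (i + 1) := by
    refine Finset.sum_congr rfl fun i hi => ?_
    have := Finset.mem_range.1 hi
    simp [shiftM]; omega
  simp only [Nat.succ_eq_add_one] at *
  rw [this]
  simp [shiftM]; omega

lemma Wgf_shift (n : ℕ) (hn : n ≠ 0) (m : ℕ → ℕ) (h0m : 1 ≤ m 0) (hmn : 2 ≤ m n) :
    Wgf n m = Wgf n (shiftM n m) := by
  rw [Wgf_Hp n m _ rfl hn h0m (by omega), Wgf_Hp n (shiftM n m) _ rfl hn (by simp [shiftM])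
    (by simp [shiftM, hn]; omega), Hp_transfer n hn m h0m hmn, sum_shiftM n hn m (by omega)]

/-- series `∑ C(K-1+j, j) j^n X^j` with `K = k+1` -/
noncomputable def Sser (k n : ℕ) : PowerSeries ℚ :=
  PowerSeries.mk fun j => (((k + j).choose j : ℕ) : ℚ) * (j : ℚ) ^ n

/-- the insertion step -/
lemma Wgf_insert (n : ℕ) (m : ℕ → ℕ) (h0 : 1 ≤ m 0) (h1 : m (n + 1) = 1) (L : ℕ)
    (hL : L = ∑ i ∈ Finset.range (n + 1), m i) :
    (L : PowerSeries ℚ) * Wgf (n + 1) m = ((L + 1 : ℕ) : PowerSeries ℚ) *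
      (PowerSeries.X * (1 - PowerSeries.X) * PowerSeries.derivative ℚ (Wgf n m) +
        (L : PowerSeries ℚ) * PowerSeries.X * Wgf n m) := by
  have hL1 : L + 1 = ∑ i ∈ Finset.range (n + 1 + 1), m i := by
    rw [Finset.sum_range_succ, ← hL, h1]
  have hLp : 1 ≤ L := by
    rw [hL, Finset.sum_range_succ']; omega
  rw [Wgf_head (n + 1) m (L + 1) hL1 (n + 1) le_rfl h1]
  have e : ∑ w ∈ (Rset (n + 1) m).filter (fun w => w.head? = some (n + 1)),
      (PowerSeries.X : PowerSeries ℚ) ^ cd w = ∑ u ∈ Rset n m, PowerSeries.X ^ (1 + dd u) := by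
    symm
    have memiff : ∀ u : List ℕ, (n + 1) :: u ∈ Rset (n + 1) m ↔ u ∈ Rset n m := by
      intro u
      rw [mem_Rset, mem_Rset]
      have hc : (∀ x, ((n + 1) :: u).count x = if x ≤ n + 1 then m x else 0) ↔
          ∀ x, u.count x = if x ≤ n then m x else 0 := by
        refine forall_congr' fun x => ?_
        rw [List.count_cons]
        by_cases hx : x = n + 1
        · subst hx; simp [h1]
        · have : ¬ (n + 1 = x) := fun e => hx e.symm
          have h2 : x ≤ n + 1 ↔ x ≤ n := by omega
          simp [this, h2]
      rw [hc]
      refine and_congr_right fun hcu => ?_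
      have hnu : n + 1 ∉ u := by
        have := hcu (n + 1)
        rw [if_neg (by omega)] at this
        exact List.count_eq_zero.1 this
      have := QSs_insert [] [n + 1] u (by simpa using hnu)
      simp only [List.nil_append, List.cons_append] at this
      rw [this]
      refine and_iff_left fun x y _ hs => ?_
      have := hs.length_le
      simp at this
    refine Finset.sum_bij (fun u _ => (n + 1) :: u) ?_ ?_ ?_ ?_
    · intro u hu
      rw [Finset.mem_filter]
      exact ⟨(memiff u).2 hu, by simp⟩
    · intro a _ b _ e; simpa using e
    · intro w hw
      rw [Finset.mem_filter] at hw
      rcases w with _ | ⟨a, u⟩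
      · simp at hw
      · have := hw.2
        simp at this
        subst this
        exact ⟨u, (memiff u).1 hw.1, rfl⟩
    · intro u hu
      have hl := length_of_mem hu
      rw [← hL] at hl
      have : u ≠ [] := by rintro rfl; simp at hl; omega
      rw [← dd_top u (n + 1) this (fun x hx => Nat.lt_succ_of_le (le_of_mem hu hx))]
      rfl
  rw [e]
  have r := rotSum n m L hL (fun u => (PowerSeries.X : PowerSeries ℚ) ^ (1 + dd u))
  rw [mul_left_comm, ← r]
  congr 1
  rw [Wgf, map_sum, Finset.mul_sum, Finset.mul_sum, ← Finset.sum_add_distrib]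
  refine Finset.sum_congr rfl fun u hu => ?_
  have hl := length_of_mem hu
  rw [← hL] at hl
  have s := sum_rot_X u
  rw [hl] at s
  rw [s]
  have d : (PowerSeries.X : PowerSeries ℚ) * PowerSeries.derivative ℚ (PowerSeries.X ^ cd u) =
      (cd u : PowerSeries ℚ) * PowerSeries.X ^ cd u := by
    rw [Derivation.leibniz_pow]
    rcases cd u with _ | c
    · simp
    · simp [pow_succ]; ring
  calc _ = (1 - PowerSeries.X) * ((cd u : PowerSeries ℚ) * PowerSeries.X ^ cd u) +
        (L : PowerSeries ℚ) * PowerSeries.X * PowerSeries.X ^ cd u := by ring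
    _ = _ := by rw [← d]; ring

lemma Sser_succ (k n : ℕ) :
    Sser k (n + 1) = PowerSeries.X * PowerSeries.derivative ℚ (Sser k n) := by
  ext j
  cases j with
  | zero => simp [Sser]
  | succ j =>
    rw [PowerSeries.coeff_succ_X_mul]
    simp [Sser, PowerSeries.coeff_derivative, pow_succ]
    ring

lemma Sser_zero (k : ℕ) : (1 - PowerSeries.X) ^ (k + 1) * Sser k 0 = 1 := by
  have := PowerSeries.invOneSubPow_val_succ_eq_mk_add_choose ℚ k
  have e : Sser k 0 = (PowerSeries.invOneSubPow ℚ (k + 1)).val := by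
    rw [this]; ext j; simp [Sser]
    rw [Nat.choose_symm_add]
  rw [e, ← PowerSeries.invOneSubPow_inv_eq_one_sub_pow]
  exact (PowerSeries.invOneSubPow ℚ (k + 1)).inv_val

/-- main formula -/
lemma main_formula (n k : ℕ) (m : ℕ → ℕ) (hm : ∀ i ≤ n, 1 ≤ m i)
    (hk : ∑ i ∈ Finset.range (n + 1), m i = k + 1 + n) :
    ((k + 1 : ℕ) : PowerSeries ℚ) * Wgf n m =
      ((k + 1 + n : ℕ) : PowerSeries ℚ) * ((1 - PowerSeries.X) ^ (k + 1 + n) * Sser k n) := by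
  induction n generalizing m with
  | zero =>
    have hm0 : m 0 = k + 1 := by simpa using hk
    have : Rset 0 m = {List.replicate (k + 1) 0} := by
      ext w
      simp only [Rset, baseL, msetList, hm0, Finset.mem_filter, List.mem_toFinset,
        List.mem_permutations, Finset.mem_singleton]
      simp only [List.range_zero, List.flatMap_nil, List.append_nil, List.perm_replicate]
      refine ⟨fun h => h.1, fun h => ⟨h, ?_⟩⟩
      subst h
      intro x y hxy hs
      have h1 : x = 0 := List.eq_of_mem_replicate (hs.subset (by simp))
      have h2 : y = 0 := List.eq_of_mem_replicate (hs.subset (by simp))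
      exact hxy (h1.trans h2.symm)
    have hc : cd (List.replicate (k + 1) 0) = 0 := by
      have : ∀ j, dd (List.replicate (j + 1) 0) = 0 := by
        intro j
        induction j with
        | zero => rfl
        | succ j ih => simpa [List.replicate_succ, dd] using ih
      have h2 := this (k + 1)
      rw [List.replicate_succ'] at h2
      simpa [cd, List.replicate_succ] using h2
    rw [Wgf, this]
    simp only [Finset.sum_singleton, hc, add_zero, Sser_zero, pow_zero]
  | succ n ih =>
    obtain ⟨b, hb⟩ : ∃ b, m (n + 1) = b + 1 := ⟨m (n + 1) - 1, by have := hm (n + 1) le_rfl; omega⟩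
    induction b generalizing m with
    | zero =>
      have hs : ∑ i ∈ Finset.range (n + 1), m i = k + 1 + n := by
        rw [Finset.sum_range_succ, hb] at hk; omega
      have h := ih m (fun i hi => hm i (by omega)) hs
      have hi := Wgf_insert n m (hm 0 (by omega)) (by simpa using hb) (k + 1 + n) hs.symm
      have hd := congrArg (PowerSeries.derivative ℚ) h
      have hne : ((k + 1 + n : ℕ) : PowerSeries ℚ) ≠ 0 := by
        have := algebraRat.charZero (PowerSeries ℚ)
        rw [Nat.cast_ne_zero]; omega
      apply mul_left_cancel₀ hne
      rw [mul_left_comm, hi, Sser_succ]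
      have hpow : PowerSeries.derivative ℚ ((1 - PowerSeries.X : PowerSeries ℚ) ^ (k + 1 + n)) =
          - (((k + 1 + n : ℕ) : PowerSeries ℚ) * (1 - PowerSeries.X) ^ (k + n)) := by
        rw [Derivation.leibniz_pow, map_sub, show k + 1 + n - 1 = k + n by omega]
        simp
      simp only [Derivation.leibniz, Derivation.map_natCast, smul_eq_mul, mul_zero, add_zero,
        hpow] at hd
      have hp2 : (1 - PowerSeries.X : PowerSeries ℚ) ^ (k + 1 + n) =
        (1 - PowerSeries.X) * (1 - PowerSeries.X) ^ (k + n) := by ring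
      have hp3 : (1 - PowerSeries.X : PowerSeries ℚ) ^ (k + 1 + (n + 1)) =
        (1 - PowerSeries.X) * (1 - PowerSeries.X) * (1 - PowerSeries.X) ^ (k + n) := by ring
      rw [hp2] at hd h
      rw [hp3, show k + 1 + (n + 1) = k + 1 + n + 1 by ring]
      linear_combination ((k + 1 + n + 1 : ℕ) : PowerSeries ℚ) *
        (PowerSeries.X * (1 - PowerSeries.X) * hd +
          ((k + 1 + n : ℕ) : PowerSeries ℚ) * PowerSeries.X * h)
    | succ b ihb =>
      rw [Wgf_shift (n + 1) (by omega) m (hm 0 (by omega)) (by omega)]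
      apply ihb
      · intro i hi
        have := hm i hi
        simp only [shiftM]; split_ifs <;> omega
      · rw [sum_shiftM _ (by omega) _ (by omega), hk]
      · simp [shiftM, hb]

lemma Wgf_QS (n : ℕ) (mlt : ℕ → ℕ) :
    Wgf n (Function.update mlt 0 1) =
      (((∑ i ∈ Finset.range n, mlt (i + 1)) + 1 : ℕ) : PowerSeries ℚ) *
        ∑ w ∈ QS n mlt, (PowerSeries.X : PowerSeries ℚ) ^ desN w := by
  rw [Wgf_head n (Function.update mlt 0 1) ((∑ i ∈ Finset.range n, mlt (i + 1)) + 1)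
    (by rw [Finset.sum_range_succ']; simp) 0 (by omega) (by simp)]
  congr 1
  symm
  have hb : baseL n (Function.update mlt 0 1) = 0 :: msetList n mlt := by
    simp [baseL, msetList]
  have memiff : ∀ w : List ℕ, 0 :: w ∈ Rset n (Function.update mlt 0 1) ↔ w ∈ QS n mlt := by
    intro w
    simp only [Rset, QS, hb, Finset.mem_filter, List.mem_toFinset, List.mem_permutations,
      List.perm_cons, isQS_iff]
    refine and_congr_right fun hp => ?_
    have h0 : 0 ∉ w := by
      rw [hp.mem_iff]; simp [msetList]
    have := QSs_insert [] [0] w (by simpa using h0)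
    simp only [List.nil_append, List.cons_append] at this
    rw [this]
    refine and_iff_left fun x y _ hs => ?_
    have := hs.length_le
    simp at this
  refine Finset.sum_bij (fun u _ => 0 :: u) ?_ ?_ ?_ ?_
  · intro u hu
    rw [Finset.mem_filter]
    exact ⟨(memiff u).2 hu, by simp⟩
  · intro a _ b _ e; simpa using e
  · intro w hw
    rw [Finset.mem_filter] at hw
    rcases w with _ | ⟨a, u⟩
    · simp at hw
    · have := hw.2
      simp at this
      subst this
      exact ⟨u, (memiff u).1 hw.1, rfl⟩
  · intro u _
    rw [desN_cd]

/-- `Σ_{m≥0} C(M−n+m, m)·mⁿ·tᵐ = (M−n+1)·Q̄_M(t)/(1−t)^{M+1}`. -/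
theorem stmt9 (n : ℕ) (mlt : ℕ → ℕ) (hm : ∀ i, 1 ≤ i → i ≤ n → 1 ≤ mlt i) :
    PowerSeries.mk
        (fun m => ((((∑ i ∈ Finset.range n, mlt (i + 1)) - n + m).choose m : ℕ) : ℚ) *
          (m : ℚ) ^ n) =
      ((((∑ i ∈ Finset.range n, mlt (i + 1)) - n + 1 : ℕ)) : PowerSeries ℚ) *
        (∑ w ∈ QS n mlt, (PowerSeries.X : PowerSeries ℚ) ^ desN w) *
        ((1 - PowerSeries.X) ^ ((∑ i ∈ Finset.range n, mlt (i + 1)) + 1))⁻¹ := by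
  have hle : n ≤ ∑ i ∈ Finset.range n, mlt (i + 1) := by
    calc n = ∑ i ∈ Finset.range n, 1 := by simp
      _ ≤ _ := Finset.sum_le_sum fun i hi => hm (i + 1) (by omega)
        (by have := Finset.mem_range.1 hi; omega)
  have hQ := Wgf_QS n mlt
  have hF := main_formula n ((∑ i ∈ Finset.range n, mlt (i + 1)) - n) (Function.update mlt 0 1)
    (by
      intro i hi
      by_cases h : i = 0
      · subst h; simp
      · rw [Function.update_of_ne h]; exact hm i (by omega) hi)
    (by rw [Finset.sum_range_succ']; simp; omega)
  generalize (∑ i ∈ Finset.range n, mlt (i + 1)) = M at *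
  rw [hQ, show M - n + 1 + n = M + 1 by omega, mul_left_comm] at hF
  have hne : ((M + 1 : ℕ) : PowerSeries ℚ) ≠ 0 := by
    have := algebraRat.charZero (PowerSeries ℚ)
    rw [Nat.cast_ne_zero]; omega
  have hF := mul_left_cancel₀ hne hF
  rw [hF]
  have hu : (1 - PowerSeries.X : PowerSeries ℚ) ^ (M + 1) *
      ((1 - PowerSeries.X : PowerSeries ℚ) ^ (M + 1))⁻¹ = 1 :=
    PowerSeries.mul_inv_cancel _ (by simp)
  rw [mul_right_comm, hu, one_mul]
  rfl
end

section
/- Let n, k, m be nonnegative integers with n, k ≥ 1. The number of barred partitions of [n] into k blocks with exactly m bars in total equals C(k−1+m, m) · m^n when counted as: first choosing how many bars go into each of the k blocks (C(k−1+m, m) ways), then placing the n integers into the m bars' positions. Formally: Σ_{Π ∈ B_{n,k}} [number of placements of m total bars among the blocks of Π such that in each block every descent has at least one bar] = C(k−1+m, m) · m^n. -/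
open scoped Classical
open Finset MvPolynomial

/-- blocks each followed by a zero -/
def zz (Bs : List (List ℕ)) : List ℕ := Bs.flatMap (· ++ [0])

theorem zz_cons (B : List ℕ) (Bs) : zz (B :: Bs) = B ++ 0 :: zz Bs := by simp [zz]
theorem zz_perm (Bs : List (List ℕ)) : (zz Bs).Perm (List.replicate Bs.length 0 ++ Bs.flatten) := by
  induction Bs with
  | nil => simp [zz]
  | cons B Bs ih =>
    rw [zz_cons]
    refine List.perm_middle.trans ?_
    simp only [List.length_cons, List.replicate_succ, List.flatten_cons, List.cons_append]
    refine List.Perm.cons _ ((ih.append_left B).trans ?_)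
    rw [← List.append_assoc, ← List.append_assoc]
    exact List.perm_append_comm.append_right _

theorem app_zero_inj : ∀ (B C X Y : List ℕ), 0 ∉ B → 0 ∉ C → B ++ 0 :: X = C ++ 0 :: Y → B = C ∧ X = Y
  | [], [], X, Y, _, _, h => by simpa using h
  | [], c :: C, X, Y, _, h2, h => by
    simp only [List.nil_append, List.cons_append, List.cons.injEq] at h
    simp [← h.1] at h2
  | b :: B, [], X, Y, h1, _, h => by
    simp only [List.nil_append, List.cons_append, List.cons.injEq] at h
    simp [h.1] at h1
  | b :: B, c :: C, X, Y, h1, h2, h => by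
    simp only [List.cons_append, List.cons.injEq] at h
    have := app_zero_inj B C X Y (fun t => h1 (by simp [t])) (fun t => h2 (by simp [t])) h.2
    exact ⟨by rw [h.1, this.1], this.2⟩

theorem zz_inj : ∀ (Bs Cs : List (List ℕ)), (∀ B ∈ Bs, 0 ∉ B) → (∀ B ∈ Cs, 0 ∉ B) →
    zz Bs = zz Cs → Bs = Cs
  | [], [], _, _, _ => rfl
  | [], C :: Cs, _, _, h => by rw [zz_cons] at h; simp [zz] at h
  | B :: Bs, [], _, _, h => by rw [zz_cons] at h; simp [zz] at h
  | B :: Bs, C :: Cs, h1, h2, h => by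
    rw [zz_cons, zz_cons] at h
    have h := app_zero_inj _ _ _ _ (h1 B (by simp)) (h2 C (by simp)) h
    rw [h.1, zz_inj Bs Cs (fun B hB => h1 B (by simp [hB])) (fun B hB => h2 B (by simp [hB])) h.2]

theorem zz_surj (U : List ℕ) : ∃ Bs, zz Bs = U ++ [0] ∧ ∀ B ∈ Bs, 0 ∉ B := by
  induction U with
  | nil => exact ⟨[[]], by simp [zz]⟩
  | cons x U ih =>
    obtain ⟨Bs, h1, h2⟩ := ih
    by_cases hx : x = 0
    · exact ⟨[] :: Bs, by simp [zz_cons, h1, hx], by simpa using h2⟩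
    · cases Bs with
      | nil => simp [zz] at h1
      | cons B Bs =>
        refine ⟨(x :: B) :: Bs, by rw [zz_cons] at h1 ⊢; simp [h1], ?_⟩
        simp only [List.mem_cons, forall_eq_or_imp] at h2 ⊢
        exact ⟨by rintro (h | h); exacts [hx h.symm, h2.1 h], h2.2⟩

theorem zz_dropLast (Bs : List (List ℕ)) (h : Bs ≠ []) : (zz Bs).dropLast ++ [0] = zz Bs := by
  obtain ⟨Cs, C, rfl⟩ := (List.eq_nil_or_concat Bs).resolve_left h
  simp [zz, ← List.append_assoc]

theorem zz_getD : ∀ (Bs : List (List ℕ)) (i : ℕ) (hi : i < Bs.length) (j : ℕ) (_ : j ≤ Bs[i].length + 1),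
    (0 :: zz Bs).getD (((Bs.map (fun B => B.length + 1)).take i).sum + j) 0 = pad Bs[i] j
  | B :: Bs, 0, _, j, hj => by
    have : 0 :: zz (B :: Bs) = (0 :: (B ++ [0])) ++ zz Bs := by simp [zz_cons]
    rw [this]
    simp only [List.getElem_cons_zero] at hj ⊢
    simp only [List.take_zero, List.sum_nil, zero_add, pad]
    rw [List.getD_append _ _ _ _ (by simp; omega)]
  | B :: Bs, i + 1, hi, j, hj => by
    have ih := zz_getD Bs i (by simpa using hi) j (by simpa using hj)
    have : 0 :: zz (B :: Bs) = (0 :: B) ++ (0 :: zz Bs) := by simp [zz_cons]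
    rw [this, List.getD_append_right _ _ _ _ (by simp; omega)]
    simp only [List.getElem_cons_succ]
    rw [← ih]
    congr 1
    simp; omega

/-- every index is an in-block index -/
theorem zz_idx : ∀ (Bs : List (List ℕ)) (g : ℕ), g < ((Bs.map (fun B => B.length + 1))).sum →
    ∃ (i : ℕ) (hi : i < Bs.length) (j : ℕ), j ≤ Bs[i].length ∧
      ((Bs.map (fun B => B.length + 1)).take i).sum + j = g
  | [], g, h => by simp at h
  | B :: Bs, g, h => by
    by_cases hg : g ≤ B.length
    · exact ⟨0, by simp, g, by simpa using hg, by simp⟩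
    · obtain ⟨i, hi, j, hj, e⟩ := zz_idx Bs (g - (B.length + 1)) (by simp at h ⊢; omega)
      exact ⟨i + 1, by simpa using hi, j, by simpa using hj, by simp at e ⊢; omega⟩

theorem offsetC_eq {k : ℕ} (c : Fin k → ℕ) (i : Fin k) : offsetC c i = ((List.ofFn c).take i).sum := by
  rw [List.sum_take_ofFn]; rfl

/-- list of blocks -/
def bl (k : ℕ) (w : List ℕ) (c : Fin k → ℕ) : List (List ℕ) := List.ofFn (blockOf k w c)

theorem bl_length (k : ℕ) (w : List ℕ) (c : Fin k → ℕ) : (bl k w c).length = k := by simp [bl]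

theorem bl_getElem (k : ℕ) (w : List ℕ) (c : Fin k → ℕ) (i : ℕ) (h : i < (bl k w c).length)
    (h' : i < k) : (bl k w c)[i] = blockOf k w c ⟨i, h'⟩ := by simp only [bl, List.getElem_ofFn]

theorem bl_flatten (k : ℕ) (w : List ℕ) (c : Fin k → ℕ) (h : ∑ i, c i = w.length) :
    (bl k w c).flatten = w := by
  have key : ∀ i ≤ k, ((bl k w c).take i).flatten = w.take ((List.ofFn c).take i).sum := by
    intro i
    induction i with
    | zero => simp
    | succ i ih =>
      intro hi
      rw [List.take_succ_eq_append_getElem (by simpa [bl] using hi),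
        List.take_succ_eq_append_getElem (by simpa using hi), List.flatten_append, ih (by omega),
        List.sum_append, List.take_add]
      simp [bl, blockOf, offsetC_eq]
  have := key k le_rfl
  rw [List.take_of_length_le (by simp [bl]), List.take_of_length_le (l := List.ofFn c) (by simp), List.sum_ofFn, h] at this
  simpa using this

theorem bl_len (k : ℕ) (w : List ℕ) (c : Fin k → ℕ) (h : ∑ i, c i = w.length) (i : Fin k) :
    (blockOf k w c i).length = c i := by
  have : offsetC c i + c i ≤ w.length := by
    rw [← h, offsetC]
    rw [← Finset.sum_filter_add_sum_filter_not Finset.univ (fun j : Fin k => (j : ℕ) < i)]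
    gcongr
    exact Finset.single_le_sum (f := c) (fun _ _ => Nat.zero_le _) (by simp)
  simp [blockOf]; omega

theorem bl_surj (k : ℕ) (Bs : List (List ℕ)) (h : Bs.length = k) :
    ∃ c : Fin k → ℕ, bl k Bs.flatten c = Bs ∧ ∑ i, c i = Bs.flatten.length := by
  subst h
  have e : List.ofFn (fun i : Fin Bs.length => Bs[i].length) = Bs.map List.length := by
    apply List.ext_getElem <;> simp
  refine ⟨fun i => Bs[i].length, ?_, ?_⟩
  · apply List.ext_getElem
    · simp [bl]
    · intro i h1 h2
      simp only [bl, List.getElem_ofFn, blockOf, offsetC_eq, e]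
      rw [← List.drop_take_succ_flatten_eq_getElem Bs i h2, List.take_succ_eq_append_getElem (by simpa using h2),
        List.sum_append, List.drop_take]
      simp
  · rw [← List.sum_ofFn, e, List.length_flatten]

theorem bl_map_len (k : ℕ) (w : List ℕ) (c : Fin k → ℕ) (h : ∑ i, c i = w.length) :
    (bl k w c).map (fun B => B.length + 1) = List.ofFn (fun i => c i + 1) := by
  apply List.ext_getElem
  · simp [bl]
  · intro i h1 h2
    simp [bl, bl_len k w c h]

theorem good_iff (n k : ℕ) (w : List ℕ) (c : Fin (k+1) → ℕ) (h : ∑ i, c i = w.length) (hw : w.length = n)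
    (b : Fin (n + (k + 1)) → ℕ) :
    GoodBars n (k+1) w c b ↔ ∀ g : Fin (n + (k + 1)),
      pad (zz (bl (k+1) w c)).dropLast (g + 1) < pad (zz (bl (k+1) w c)).dropLast g → 1 ≤ b g := by
  have hp : ∀ t, pad (zz (bl (k+1) w c)).dropLast t = (0 :: zz (bl (k+1) w c)).getD t 0 := by
    intro t
    rw [pad, zz_dropLast _ (by simp [bl])]
  have hlen := bl_map_len (k+1) w c h
  have hgap : ∀ i j, gapIdx c i j = (((bl (k+1) w c).map (fun B => B.length + 1)).take i).sum + j := by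
    intro i j
    rw [hlen, List.sum_take_ofFn]; rfl
  have hget : ∀ (i : Fin (k+1)) j, j ≤ c i + 1 →
      pad (zz (bl (k+1) w c)).dropLast (gapIdx c i j) = pad (blockOf (k+1) w c i) j := by
    intro i j hj
    rw [hp, hgap, zz_getD _ i (by rw [bl_length]; exact i.2) j
      (by rw [bl_getElem _ _ _ _ _ i.2, bl_len _ w c h]; exact hj), bl_getElem _ _ _ _ _ i.2]
  constructor
  · intro H g hg
    obtain ⟨i, hi, j, hj, e⟩ := zz_idx (bl (k+1) w c) g (by
      rw [hlen, List.sum_ofFn, Finset.sum_add_distrib, h, hw]; simp)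
    have hi' : i < k + 1 := by simpa [bl] using hi
    have hj' : j ≤ c ⟨i, hi'⟩ := by
      rwa [bl_getElem _ _ _ _ _ hi', bl_len _ w c h] at hj
    have e1 : (g : ℕ) = gapIdx c ⟨i, hi'⟩ j := by rw [hgap]; exact e.symm
    have e2 : (g : ℕ) + 1 = gapIdx c ⟨i, hi'⟩ (j + 1) := by rw [e1]; rfl
    rw [e2, e1, hget _ _ (by omega), hget _ _ (by omega)] at hg
    exact H ⟨i, hi'⟩ j hj' hg g e1
  · intro H i j hj hd g hg
    apply H g
    have e2 : (g : ℕ) + 1 = gapIdx c i (j + 1) := by rw [hg]; rfl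
    rwa [e2, hg, hget _ _ (by omega), hget _ _ (by omega)]

theorem stepA (n k m : ℕ) : (∑ P ∈ Bnk n (k+1),
        ((Finset.Nat.antidiagonalTuple (n + (k+1)) m).filter (GoodBars n (k+1) P.1 P.2)).card) =
    ∑ U ∈ (List.replicate k 0 ++ List.range' 1 n).permutations.toFinset,
      ((Finset.Nat.antidiagonalTuple (n + (k+1)) m).filter (fun b => ∀ g : Fin (n + (k + 1)),
      pad U (g + 1) < pad U g → 1 ≤ b g)).card := by
  have hmem : ∀ P ∈ Bnk n (k+1), P.1.Perm (List.range' 1 n) ∧ P.1.length = n ∧ ∑ i, P.2 i = P.1.length := by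
    intro P hP
    simp only [Bnk, Sn, Finset.mem_product, List.mem_toFinset, List.mem_permutations,
      Finset.Nat.mem_antidiagonalTuple] at hP
    have : P.1.length = n := by simpa using hP.1.length_eq
    exact ⟨hP.1, this, by rw [hP.2, this]⟩
  have hz : ∀ P ∈ Bnk n (k+1), ∀ B ∈ bl (k+1) P.1 P.2, 0 ∉ B := by
    intro P hP B hB h0
    obtain ⟨h1, h2, h3⟩ := hmem P hP
    have : 0 ∈ (bl (k+1) P.1 P.2).flatten := List.mem_flatten.2 ⟨B, hB, h0⟩
    rw [bl_flatten _ _ _ h3, h1.mem_iff] at this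
    simp at this
  refine Finset.sum_nbij (fun P => (zz (bl (k+1) P.1 P.2)).dropLast) ?_ ?_ ?_ ?_
  · intro P hP
    obtain ⟨h1, h2, h3⟩ := hmem P hP
    simp only [List.mem_toFinset, List.mem_permutations]
    have h4 := zz_perm (bl (k+1) P.1 P.2)
    rw [← zz_dropLast _ (by simp [bl]), bl_flatten _ _ _ h3] at h4
    have h5 : (bl (k+1) P.1 P.2).length = k + 1 := by simp [bl]
    rw [h5, List.replicate_succ] at h4
    have h6 := (List.perm_append_comm.trans h4)
    exact (List.Perm.cons_inv h6).trans (h1.append_left _)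
  · intro P hP Q hQ h
    have hP := Finset.mem_coe.1 hP
    have hQ := Finset.mem_coe.1 hQ
    obtain ⟨h1, h2, h3⟩ := hmem P hP
    obtain ⟨h1', h2', h3'⟩ := hmem Q hQ
    have h' : zz (bl (k+1) P.1 P.2) = zz (bl (k+1) Q.1 Q.2) := by
      rw [← zz_dropLast (bl (k+1) P.1 P.2) (by simp [bl]), ← zz_dropLast (bl (k+1) Q.1 Q.2) (by simp [bl])]
      exact congrArg (· ++ [0]) h
    have h'' := zz_inj _ _ (hz P hP) (hz Q hQ) h'
    ext1
    · rw [← bl_flatten _ _ _ h3, ← bl_flatten _ _ _ h3', h'']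
    · funext i
      rw [← bl_len _ _ _ h3, ← bl_len _ _ _ h3']
      rw [bl, bl, List.ofFn_inj] at h''
      rw [h'']
  · intro U hU
    simp only [List.coe_toFinset, Set.mem_ofPred_eq, List.mem_permutations] at hU
    obtain ⟨Bs, h1, h2⟩ := zz_surj U
    have h3 := zz_perm Bs
    rw [h1] at h3
    have h5 : (List.replicate Bs.length 0 ++ Bs.flatten).Perm
        (List.replicate (k+1) 0 ++ List.range' 1 n) := by
      refine h3.symm.trans ((hU.append_right [0]).trans ?_)
      rw [List.replicate_succ]
      exact List.perm_append_comm
    have hnf : 0 ∉ Bs.flatten := by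
      intro h
      obtain ⟨B, hB, h⟩ := List.mem_flatten.1 h
      exact h2 B hB h
    have h6 : Bs.length = k + 1 := by
      have := h5.count_eq 0
      simpa [List.count_append, List.count_eq_zero_of_not_mem hnf, List.count_eq_zero_of_not_mem
        (show 0 ∉ List.range' 1 n by simp)] using this
    rw [h6, List.perm_append_left_iff] at h5
    obtain ⟨c, hc1, hc2⟩ := bl_surj (k+1) Bs h6
    refine ⟨(Bs.flatten, c), ?_, ?_⟩
    · simp only [Bnk, Sn, Finset.mem_coe, Finset.mem_product, List.mem_toFinset, List.mem_permutations,
        Finset.Nat.mem_antidiagonalTuple]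
      exact ⟨h5, by rw [hc2, h5.length_eq]; simp⟩
    · simp [hc1, h1]
  · intro P hP
    obtain ⟨h1, h2, h3⟩ := hmem P hP
    congr 1
    apply Finset.filter_congr
    intro b _
    exact good_iff n k P.1 P.2 h3 h2 b

theorem pad_succ (U : List ℕ) (i : ℕ) : pad U (i + 1) = U.getD i 0 := by
  simp only [pad, List.getD_cons_succ]
  rcases lt_or_ge i U.length with h | h
  · rw [List.getD_append _ _ _ _ h]
  · rw [List.getD_append_right _ _ _ _ h, List.getD_eq_default _ _ h]
    rcases i - U.length with _ | t <;> simp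

/-- extend a tuple by zero -/
def ex {N : ℕ} (b : Fin N → ℕ) (j : ℕ) : ℕ := if h : j < N then b ⟨j, h⟩ else 0

/-- partial sums -/
def ps {N : ℕ} (b : Fin N → ℕ) (t : ℕ) : ℕ := ∑ j ∈ Finset.range t, ex b j

theorem ps_succ {N : ℕ} (b : Fin N → ℕ) (t : ℕ) : ps b (t + 1) = ps b t + ex b t :=
  Finset.sum_range_succ _ _

theorem ps_total {N : ℕ} (b : Fin N → ℕ) : ps b N = ∑ i, b i := by
  rw [ps, Finset.sum_range]
  simp [ex]

/-- sorted words of pairs -/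
def GoodL (m : ℕ) (base : List ℕ) (L : List (ℕ ×ₗ ℕ)) : Prop :=
  L.Pairwise (· ≤ ·) ∧ (L.map (fun x => (ofLex x).2)).Perm base ∧ ∀ x ∈ L, x ≤ toLex (m, 0)

/-- the encoding -/
def Psi (N : ℕ) (p : Σ _ : List ℕ, Fin (N + 1) → ℕ) : List (ℕ ×ₗ ℕ) :=
  List.ofFn (fun i : Fin N => toLex (ps p.2 (i + 1), p.1.getD i 0))

theorem Psi_inj (N m : ℕ) (p q : Σ _ : List ℕ, Fin (N + 1) → ℕ) (hp : p.1.length = N)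
    (hq : q.1.length = N) (hp2 : ∑ i, p.2 i = m) (hq2 : ∑ i, q.2 i = m) (h : Psi N p = Psi N q) :
    p = q := by
  obtain ⟨U, b⟩ := p
  obtain ⟨V, c⟩ := q
  simp only at hp hq hp2 hq2
  simp only [Psi, List.ofFn_inj] at h
  have h' : ∀ i < N, ps b (i + 1) = ps c (i + 1) ∧ U.getD i 0 = V.getD i 0 := by
    intro i hi
    have := congrFun h ⟨i, hi⟩
    simpa using this
  have hU : U = V := by
    apply List.ext_getElem (by rw [hp, hq])
    intro i h1 h2
    have := (h' i (by omega)).2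
    rwa [List.getD_eq_getElem _ _ h1, List.getD_eq_getElem _ _ h2] at this
  have hps : ∀ t ≤ N + 1, ps b t = ps c t := by
    intro t ht
    rcases t with _ | t
    · simp [ps]
    · rcases Nat.lt_or_ge t N with h1 | h1
      · exact (h' t h1).1
      · have : t = N := by omega
        subst this
        rw [ps_total, ps_total, hp2, hq2]
  have hb : b = c := by
    funext j
    have h1 := hps (j + 1) (by omega)
    rw [ps_succ, ps_succ, hps j (by omega)] at h1
    have h2 := Nat.add_left_cancel h1
    simp only [ex, j.2, dif_pos] at h2
    exact h2
  rw [hU, hb]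

theorem Psi_good (N m : ℕ) (base U : List ℕ) (b : Fin (N + 1) → ℕ) (hl : U.length = N)
    (hU : U.Perm base) (hb : ∑ i, b i = m)
    (hg : ∀ g : Fin (N + 1), pad U (g + 1) < pad U g → 1 ≤ b g) : GoodL m base (Psi N ⟨U, b⟩) := by
  let F : ℕ → ℕ ×ₗ ℕ := fun t => toLex (ps b (t + 1), U.getD t 0)
  have step : ∀ i, i < N → F i ≤ F (i + 1) := by
    intro i hi
    simp only [F]
    rw [Prod.Lex.toLex_le_toLex]
    simp only
    rw [ps_succ b (i + 1)]
    have h1 := hg ⟨i + 1, by omega⟩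
    simp only [pad_succ] at h1
    have h2 : ex b (i + 1) = b ⟨i + 1, by omega⟩ := by simp [ex, hi]
    rw [h2]
    by_cases h3 : U.getD (i + 1) 0 < U.getD i 0
    · have := h1 h3
      left; omega
    · omega
  have mono : ∀ i j, i ≤ j → j ≤ N → F i ≤ F j := by
    intro i j hij
    induction j, hij using Nat.le_induction with
    | base => intro _; exact le_rfl
    | succ j hij ih => intro hj; exact (ih (by omega)).trans (step j (by omega))
  have FN : F N = toLex (m, 0) := by
    simp only [F]
    rw [ps_total, hb, List.getD_eq_default _ _ hl.le]
  refine ⟨?_, ?_, ?_⟩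
  · rw [Psi, List.pairwise_ofFn]
    intro i j hij
    exact mono i j (by exact_mod_cast hij.le) (by omega)
  · have : (Psi N ⟨U, b⟩).map (fun x => (ofLex x).2) = U := by
      apply List.ext_getElem
      · simp [Psi, hl]
      · intro i h1 h2
        simp [Psi, h2]
    rw [this]
    exact hU
  · intro x hx
    rw [Psi, List.mem_ofFn] at hx
    obtain ⟨i, rfl⟩ := hx
    rw [← FN]
    exact mono i N (by omega) le_rfl

theorem Psi_surj (N m : ℕ) (base : List ℕ) (hbase : base.length = N) (L : List (ℕ ×ₗ ℕ))
    (hL : GoodL m base L) : ∃ (U : List ℕ) (b : Fin (N + 1) → ℕ), U.length = N ∧ U.Perm base ∧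
      ∑ i, b i = m ∧ (∀ g : Fin (N + 1), pad U (g + 1) < pad U g → 1 ≤ b g) ∧ Psi N ⟨U, b⟩ = L := by
  obtain ⟨h1, h2, h3⟩ := hL
  have hlen : L.length = N := by rw [← hbase, ← h2.length_eq]; simp
  let F : ℕ → ℕ ×ₗ ℕ := fun t => L.getD t (toLex (m, 0))
  have Fmono : ∀ i, F i ≤ F (i + 1) := by
    intro i
    simp only [F]
    rcases Nat.lt_or_ge (i + 1) L.length with h | h
    · rw [List.getD_eq_getElem _ _ h, List.getD_eq_getElem _ _ (by omega)]
      exact List.pairwise_iff_getElem.1 h1 i (i + 1) (by omega) h (by omega)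
    · rw [List.getD_eq_default _ _ h]
      rcases Nat.lt_or_ge i L.length with h' | h'
      · rw [List.getD_eq_getElem _ _ h']
        exact h3 _ (List.getElem_mem _)
      · rw [List.getD_eq_default _ _ h']
  have Fstep : ∀ i, (ofLex (F i)).1 < (ofLex (F (i + 1))).1 ∨
      (ofLex (F i)).1 = (ofLex (F (i + 1))).1 ∧ (ofLex (F i)).2 ≤ (ofLex (F (i + 1))).2 := by
    intro i
    exact Prod.Lex.le_iff.1 (Fmono i)
  let G : ℕ → ℕ := fun t => Nat.casesOn t 0 (fun t => (ofLex (F t)).1)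
  have G0 : G 0 = 0 := rfl
  have GS : ∀ t, G (t + 1) = (ofLex (F t)).1 := fun _ => rfl
  have Gm : Monotone G := by
    apply monotone_nat_of_le_succ
    intro t
    rcases t with _ | t
    · rw [G0]; exact Nat.zero_le _
    · rw [GS, GS]
      have := Fstep t
      omega
  let b : Fin (N + 1) → ℕ := fun j => G (j + 1) - G j
  have hps : ∀ t ≤ N + 1, ps b t = G t := by
    intro t ht
    have := Finset.sum_range_tsub Gm t
    rw [G0, Nat.sub_zero] at this
    rw [← this, ps]
    apply Finset.sum_congr rfl
    intro j hj
    have : j < N + 1 := by have := Finset.mem_range.1 hj; omega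
    simp [ex, this, b]
  have hUF : ∀ t, (L.map (fun x => (ofLex x).2)).getD t 0 = (ofLex (F t)).2 := by
    intro t
    simp only [F]
    rcases Nat.lt_or_ge t L.length with h | h
    · rw [List.getD_eq_getElem _ _ h, List.getD_eq_getElem _ _ (by simpa using h)]
      simp
    · rw [List.getD_eq_default _ _ h, List.getD_eq_default _ _ (by simpa using h)]
      simp
  refine ⟨L.map (fun x => (ofLex x).2), b, by simpa using hlen, h2, ?_, ?_, ?_⟩
  · rw [← ps_total, hps _ le_rfl, GS]
    simp only [F]
    rw [List.getD_eq_default _ _ hlen.le]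
    simp
  · rintro ⟨g, hg⟩ hd
    rcases g with _ | i
    · simp [pad] at hd
    · simp only [pad_succ, hUF] at hd
      simp only [b, GS]
      have := Fstep i
      omega
  · apply List.ext_getElem
    · simp [Psi, hlen]
    · intro i hi1 hi2
      simp only [Psi, List.getElem_ofFn]
      rw [hUF, hps _ (by omega), GS]
      simp only [F]
      rw [List.getD_eq_getElem _ _ hi2]
      rfl

/-- the multiset of pairs -/
def MM (n k m : ℕ) (p : Sym (Fin (m + 1)) k × (Fin n → Fin m)) : Multiset (ℕ ×ₗ ℕ) :=
  (p.1 : Multiset (Fin (m + 1))).map (fun a : Fin (m + 1) => toLex ((a : ℕ), 0)) +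
    (Finset.univ : Finset (Fin n)).val.map (fun i : Fin n => toLex ((p.2 i : ℕ), (i : ℕ) + 1))

theorem MM_inj (n k m : ℕ) : Function.Injective (MM n k m) := by
  rintro ⟨Z, f⟩ ⟨Y, g⟩ h
  have hf : ∀ (Z : Sym (Fin (m + 1)) k) (f : Fin n → Fin m),
      (MM n k m (Z, f)).filter (fun x => (ofLex x).2 = 0) =
      (Z : Multiset (Fin (m + 1))).map (fun a : Fin (m + 1) => toLex ((a : ℕ), 0)) := by
    intro Z f
    rw [MM, Multiset.filter_add, Multiset.filter_eq_self.2, Multiset.filter_eq_nil.2, add_zero]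
    · intro a ha
      obtain ⟨i, _, rfl⟩ := Multiset.mem_map.1 ha
      simp
    · intro a ha
      obtain ⟨i, _, rfl⟩ := Multiset.mem_map.1 ha
      simp
  have h1 : Z = Y := by
    have := hf Z f
    rw [h, hf Y g] at this
    apply Sym.coe_injective
    refine Multiset.map_injective ?_ this.symm
    intro a b hab
    have : (a : ℕ) = b := by simpa using hab
    exact Fin.ext this
  have h2 : f = g := by
    funext i
    have : toLex ((f i : ℕ), (i : ℕ) + 1) ∈ MM n k m (Y, g) := by
      rw [← h, MM]
      exact Multiset.mem_add.2 (Or.inr (Multiset.mem_map.2 ⟨i, by simp, rfl⟩))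
    rw [MM, Multiset.mem_add, Multiset.mem_map, Multiset.mem_map] at this
    rcases this with ⟨a, _, ha⟩ | ⟨j, _, hj⟩
    · simp at ha
    · simp only [EmbeddingLike.apply_eq_iff_eq, Prod.mk.injEq, Nat.add_right_cancel_iff] at hj
      have hij : j = i := Fin.ext hj.2
      subst hij
      exact Fin.ext hj.1.symm
  rw [h1, h2]

theorem range_univ (n : ℕ) : (Finset.univ : Finset (Fin n)).val.map (fun i : Fin n => (i : ℕ) + 1) =
    (List.range' 1 n : Multiset ℕ) := by
  rw [Fin.univ_val_map]
  congr 1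
  apply List.ext_getElem
  · simp
  · intro i h1 h2
    simp [add_comm]

theorem MM_snd (n k m : ℕ) (p) : (MM n k m p).map (fun x => (ofLex x).2) =
    ((List.replicate k 0 ++ List.range' 1 n : List ℕ) : Multiset ℕ) := by
  rw [← Multiset.coe_add, ← range_univ, MM, Multiset.map_add, Multiset.map_map, Multiset.map_map]
  congr 1
  simp [Function.comp_def, ← Multiset.coe_replicate]

theorem MM_le (n k m : ℕ) (p) : ∀ x ∈ MM n k m p, x ≤ toLex (m, 0) := by
  intro x hx
  rw [MM, Multiset.mem_add, Multiset.mem_map, Multiset.mem_map] at hx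
  rcases hx with ⟨a, _, rfl⟩ | ⟨j, _, rfl⟩
  · rw [Prod.Lex.toLex_le_toLex]
    have := a.2
    simp only
    omega
  · rw [Prod.Lex.toLex_le_toLex]
    exact Or.inl (p.2 j).2

theorem MM_surj (n k m : ℕ) (M : Multiset (ℕ ×ₗ ℕ)) (h1 : M.map (fun x => (ofLex x).2) =
    ((List.replicate k 0 ++ List.range' 1 n : List ℕ) : Multiset ℕ))
    (h2 : ∀ x ∈ M, x ≤ toLex (m, 0)) : ∃ p, MM n k m p = M := by
  have h3 : ∀ x ∈ M, (ofLex x).1 < m ∨ (ofLex x).1 = m ∧ (ofLex x).2 ≤ 0 :=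
    fun x hx => Prod.Lex.le_iff.1 (h2 x hx)
  have hc : (M.filter (fun x => (ofLex x).2 = 0)).card = k := by
    have := congrArg (Multiset.count 0) h1
    rw [Multiset.count_map, Multiset.coe_count, List.count_append, List.count_replicate_self,
      List.count_eq_zero_of_not_mem (show 0 ∉ List.range' 1 n by simp)] at this
    simpa [eq_comm] using this
  have hf : ∀ i : Fin n, ∃ a : Fin m, toLex ((a : ℕ), (i : ℕ) + 1) ∈ M := by
    intro i
    have : (i : ℕ) + 1 ∈ M.map (fun x => (ofLex x).2) := by
      rw [h1, Multiset.mem_coe, List.mem_append, List.mem_range'_1]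
      right; omega
    obtain ⟨x, hx, e⟩ := Multiset.mem_map.1 this
    have h4 := h3 x hx
    refine ⟨⟨(ofLex x).1, by omega⟩, ?_⟩
    rw [← e]
    exact hx
  choose f hf using hf
  refine ⟨(⟨(M.filter (fun x => (ofLex x).2 = 0)).map (fun x => Fin.ofNat (m + 1) (ofLex x).1),
    by rw [Multiset.card_map, hc]⟩, f), ?_⟩
  refine Eq.trans ?_ (Multiset.filter_add_not (fun x => (ofLex x).2 = 0) M)
  rw [MM]
  congr 1
  · simp only [Sym.coe_mk, Multiset.map_map]
    conv_rhs => rw [← Multiset.map_id (M.filter (fun x => (ofLex x).2 = 0))]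
    apply Multiset.map_congr rfl
    intro x hx
    obtain ⟨hx1, hx2⟩ := Multiset.mem_filter.1 hx
    have h4 := h3 x hx1
    have h5 : (ofLex x).1 % (m + 1) = (ofLex x).1 := Nat.mod_eq_of_lt (by omega)
    simp only [Function.comp, Fin.val_ofNat, h5, id]
    rw [← hx2]
    rfl
  · apply Multiset.eq_of_le_of_card_le
    · rw [Multiset.le_iff_subset]
      · intro x hx
        obtain ⟨i, _, rfl⟩ := Multiset.mem_map.1 hx
        exact Multiset.mem_filter.2 ⟨hf i, by simp⟩
      · apply Multiset.Nodup.map _ Finset.univ.nodup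
        intro i j hij
        have : (i : ℕ) = j := by
          have := congrArg (fun x => (ofLex x).2) hij
          simpa using this
        exact Fin.ext this
    · have h6 := congrArg Multiset.card h1
      have h7 := congrArg Multiset.card (Multiset.filter_add_not (fun x : ℕ ×ₗ ℕ => (ofLex x).2 = 0) M)
      rw [Multiset.card_add, hc] at h7
      simp at h6
      simp
      omega

theorem stepB (n k m : ℕ) :
    ∑ U ∈ (List.replicate k 0 ++ List.range' 1 n).permutations.toFinset,
      ((Finset.Nat.antidiagonalTuple (n + (k+1)) m).filter (fun b => ∀ g : Fin (n + (k + 1)),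
      pad U (g + 1) < pad U g → 1 ≤ b g)).card = (k + m).choose m * m ^ n := by
  have hbase : (List.replicate k 0 ++ List.range' 1 n).length = n + k := by simp [add_comm]
  have hT : Fintype.card (Sym (Fin (m + 1)) k × (Fin n → Fin m)) = (k + m).choose m * m ^ n := by
    rw [Fintype.card_prod, Sym.card_sym_eq_choose]
    simp only [Fintype.card_fin, Fintype.card_fun]
    congr 1
    rw [show m + 1 + k - 1 = m + k by omega, ← Nat.choose_symm_add, add_comm]
  rw [← hT, ← Finset.card_sigma, ← Finset.card_univ]
  have e1 := Finset.card_image_of_injective (Finset.univ : Finset (Sym (Fin (m + 1)) k × (Fin n → Fin m)))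
    (f := fun p => (MM n k m p).sort (· ≤ ·)) (by
      intro p q h
      apply MM_inj
      have := congrArg (fun l : List (ℕ ×ₗ ℕ) => (l : Multiset (ℕ ×ₗ ℕ))) h
      simpa using this)
  rw [← e1]
  have hS : ∀ p : (Σ _ : List ℕ, Fin (n + k + 1) → ℕ), p ∈ ((List.replicate k 0 ++ List.range' 1 n).permutations.toFinset.sigma (fun U => (Finset.Nat.antidiagonalTuple (n + (k+1)) m).filter (fun b : Fin (n + (k + 1)) → ℕ => ∀ g : Fin (n + (k + 1)),
      pad U (g + 1) < pad U g → 1 ≤ b g))) ↔ p.1.Perm (List.replicate k 0 ++ List.range' 1 n) ∧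
        ∑ i, p.2 i = m ∧ ∀ g : Fin (n + k + 1), pad p.1 (g + 1) < pad p.1 g → 1 ≤ p.2 g := by
    intro p
    rw [Finset.mem_sigma, List.mem_toFinset, List.mem_permutations, Finset.mem_filter,
      Finset.Nat.mem_antidiagonalTuple]
    rfl
  have e2 := Finset.card_image_of_injOn (f := Psi (n + k)) (s := ((List.replicate k 0 ++ List.range' 1 n).permutations.toFinset.sigma (fun U => (Finset.Nat.antidiagonalTuple (n + (k+1)) m).filter (fun b : Fin (n + (k + 1)) → ℕ => ∀ g : Fin (n + (k + 1)),
      pad U (g + 1) < pad U g → 1 ≤ b g)))) (by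
    intro p hp q hq h
    have hp := (hS p).1 (Finset.mem_coe.1 hp)
    have hq := (hS q).1 (Finset.mem_coe.1 hq)
    exact Psi_inj (n + k) m p q (by rw [hp.1.length_eq, hbase]) (by rw [hq.1.length_eq, hbase])
      hp.2.1 hq.2.1 h)
  refine e2.symm.trans ?_
  congr 1
  ext L
  rw [Finset.mem_image, Finset.mem_image]
  trans GoodL m (List.replicate k 0 ++ List.range' 1 n) L
  · constructor
    · rintro ⟨p, hp, rfl⟩
      have hp := (hS p).1 hp
      exact Psi_good (n + k) m _ p.1 p.2 (by rw [hp.1.length_eq, hbase]) hp.1 hp.2.1 hp.2.2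
    · intro hL
      obtain ⟨U, b, _, h2, h3, h4, h5⟩ := Psi_surj (n + k) m _ hbase L hL
      exact ⟨⟨U, b⟩, (hS ⟨U, b⟩).2 ⟨h2, h3, h4⟩, h5⟩
  · constructor
    · rintro ⟨h1, h2, h3⟩
      obtain ⟨p, hp⟩ := MM_surj n k m (L : Multiset (ℕ ×ₗ ℕ))
        (by rw [Multiset.map_coe]; exact Multiset.coe_eq_coe.2 h2) (by simpa using h3)
      refine ⟨p, Finset.mem_univ _, ?_⟩
      apply List.Perm.eq_of_pairwise (le := (· ≤ ·)) (fun a b _ _ => le_antisymm)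
        (Multiset.pairwise_sort _ _) h1
      rw [← Multiset.coe_eq_coe, Multiset.sort_eq, hp]
    · rintro ⟨p, _, rfl⟩
      refine ⟨Multiset.pairwise_sort _ _, ?_, ?_⟩
      · rw [← Multiset.coe_eq_coe, ← Multiset.map_coe, Multiset.sort_eq, MM_snd]
      · intro x hx
        exact MM_le n k m p x ((Multiset.mem_sort _).1 hx)

/-- the number of barred partitions of `[n]` into `k` blocks with exactly `m`
bars equals `C(k−1+m, m)·mⁿ`. -/
theorem stmt11 (n k m : ℕ) (hn : 1 ≤ n) (hk : 1 ≤ k) :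
    (∑ P ∈ Bnk n k,
        ((Finset.Nat.antidiagonalTuple (n + k) m).filter (GoodBars n k P.1 P.2)).card) =
      (k - 1 + m).choose m * m ^ n := by
  obtain ⟨k, rfl⟩ : ∃ k', k = k' + 1 := ⟨k - 1, by omega⟩
  rw [stepA, stepB]
  rfl
end

section
/- Let M = {1^{m_1}, ..., n^{m_n}} with all m_i ≥ 1 and total size M, and k = M − n + 1. Then (M−n+1)·Q̄_M(t)/(1−t)^{M+1} = Σ_{Π ∈ B̄_{n,k}} t^{bar(Π)} as formal power series, where B̄_{n,k} is the set of barred partitions of [n] into k blocks and bar(Π) is the total number of bars. -/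
open scoped Classical
open Finset MvPolynomial

section Alg

variable {R : Type*} [CommRing R]

/-- descent weight of a pair of consecutive letters -/
def tw (t : R) (p x : ℕ) : R := if x < p then t else 1

/-- subset convolution -/
def sconv (f h : Finset ℕ → R) (S : Finset ℕ) : R := ∑ T ∈ S.powerset, f T * h (S \ T)

theorem tri1 (g : Finset ℕ → Finset ℕ → Finset ℕ → R) (S : Finset ℕ) :
    ∑ V ∈ S.powerset, ∑ T ∈ V.powerset, g T (V \ T) (S \ V) =
      ∑ T ∈ S.powerset, ∑ W ∈ (S \ T).powerset, g T W ((S \ T) \ W) := by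
  rw [Finset.sum_sigma', Finset.sum_sigma']
  refine Finset.sum_bij' (fun a _ => ⟨a.2, a.1 \ a.2⟩) (fun a _ => ⟨a.1 ∪ a.2, a.1⟩) ?_ ?_ ?_ ?_ ?_
  · rintro ⟨V, T⟩ h
    simp only [Finset.mem_sigma, Finset.mem_powerset] at h ⊢
    exact ⟨h.2.trans h.1, Finset.sdiff_subset_sdiff h.1 (Finset.Subset.refl _)⟩
  · rintro ⟨T, W⟩ h
    simp only [Finset.mem_sigma, Finset.mem_powerset] at h ⊢
    exact ⟨Finset.union_subset h.1 (h.2.trans Finset.sdiff_subset), Finset.subset_union_left⟩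
  · rintro ⟨V, T⟩ h
    simp only [Finset.mem_sigma, Finset.mem_powerset] at h ⊢
    simp [Finset.union_sdiff_of_subset h.2]
  · rintro ⟨T, W⟩ h
    simp only [Finset.mem_sigma, Finset.mem_powerset] at h ⊢
    have : (T ∪ W) \ T = W := by
      ext a
      have := @h.2 a
      simp only [Finset.mem_sdiff, Finset.mem_union] at this ⊢
      tauto
    simp [this]
  · rintro ⟨V, T⟩ h
    simp only [Finset.mem_sigma, Finset.mem_powerset] at h ⊢
    congr 1
    ext a
    have h1 := @h.1 a
    have h2 := @h.2 a
    simp only [Finset.mem_sdiff] at *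
    tauto

theorem tri2 (g : Finset ℕ → Finset ℕ → R) (S : Finset ℕ) :
    ∑ T ∈ S.powerset, ∑ W ∈ (S \ T).powerset, g T W =
      ∑ W ∈ S.powerset, ∑ T ∈ (S \ W).powerset, g T W := by
  apply Finset.sum_comm'
  intro T W
  simp only [Finset.mem_powerset, Finset.subset_sdiff]
  constructor
  · rintro ⟨h1, h2, h3⟩; exact ⟨⟨h1, h3.symm⟩, h2⟩
  · rintro ⟨⟨h1, h3⟩, h2⟩; exact ⟨h1, h2, h3.symm⟩

theorem swapE (g : ℕ → Finset ℕ → Finset ℕ → R) (U : Finset ℕ) :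
    ∑ S ∈ U.powerset, ∑ y ∈ S, g y (S.erase y) (U \ S) =
      ∑ y ∈ U, ∑ S ∈ (U.erase y).powerset, g y S ((U.erase y) \ S) := by
  rw [Finset.sum_sigma', Finset.sum_sigma']
  refine Finset.sum_bij' (fun a _ => ⟨a.2, a.1.erase a.2⟩) (fun a _ => ⟨insert a.1 a.2, a.1⟩) ?_ ?_ ?_ ?_ ?_
  · rintro ⟨S, y⟩ h
    simp only [Finset.mem_sigma, Finset.mem_powerset] at h ⊢
    exact ⟨h.1 h.2, Finset.erase_subset_erase _ h.1⟩
  · rintro ⟨y, S⟩ h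
    simp only [Finset.mem_sigma, Finset.mem_powerset] at h ⊢
    exact ⟨Finset.insert_subset h.1 (h.2.trans (Finset.erase_subset _ _)), Finset.mem_insert_self _ _⟩
  · rintro ⟨S, y⟩ h
    simp only [Finset.mem_sigma, Finset.mem_powerset] at h ⊢
    simp [Finset.insert_erase h.2]
  · rintro ⟨y, S⟩ h
    simp only [Finset.mem_sigma, Finset.mem_powerset] at h ⊢
    have : y ∉ S := fun hy => by simpa using h.2 hy
    simp [Finset.erase_insert this]
  · rintro ⟨S, y⟩ h
    simp only [Finset.mem_sigma, Finset.mem_powerset] at h ⊢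
    congr 1
    ext a
    have h1 := @h.1 a
    have h2 := h.2
    by_cases hay : a = y
    · subst hay; simp [h2]
    · simp [hay]

theorem sconv_assoc (f g h : Finset ℕ → R) (S : Finset ℕ) :
    sconv (sconv f g) h S = sconv f (sconv g h) S := by
  simp only [sconv, Finset.sum_mul, Finset.mul_sum]
  rw [tri1 (fun T W Q => f T * g W * h Q) S]
  simp only [mul_assoc]

theorem sconv_congr {f f' h h' : Finset ℕ → R} {S : Finset ℕ}
    (hf : ∀ T ⊆ S, f T = f' T) (hh : ∀ T ⊆ S, h T = h' T) : sconv f h S = sconv f' h' S := by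
  unfold sconv
  refine Finset.sum_congr rfl fun T hT => ?_
  rw [hf T (Finset.mem_powerset.1 hT), hh _ Finset.sdiff_subset]

theorem sconv_one (f h : Finset ℕ → R) (S : Finset ℕ) (h0 : f ∅ = 1)
    (h1 : ∀ T ⊆ S, T ≠ ∅ → f T = 0) : sconv f h S = h S := by
  unfold sconv
  rw [Finset.sum_eq_single ∅]
  · simp [h0]
  · intro T hT hne
    rw [h1 T (Finset.mem_powerset.1 hT) hne, zero_mul]
  · simp

/-- fuel version of the weighted sum over arrangements of a set -/
def aAux (t : R) (x : ℕ) : ℕ → ℕ → Finset ℕ → R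
  | 0, p, _ => tw t p x
  | n + 1, p, S => ∑ y ∈ S, tw t p y * aAux t x n y (S.erase y)

/-- weighted sum over arrangements `w` of `S`, of `t ^ des (p w x)` -/
def aP (t : R) (p x : ℕ) (S : Finset ℕ) : R := aAux t x S.card p S

theorem aP_empty (t : R) (p x : ℕ) : aP t p x ∅ = tw t p x := by simp [aP, aAux]

theorem aP_ne (t : R) (p x : ℕ) {S : Finset ℕ} (hS : S.Nonempty) :
    aP t p x S = ∑ y ∈ S, tw t p y * aP t y x (S.erase y) := by
  obtain ⟨n, hn⟩ : ∃ n, S.card = n + 1 := ⟨S.card - 1, by have := hS.card_pos; omega⟩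
  unfold aP
  rw [hn, aAux]
  refine Finset.sum_congr rfl fun y hy => ?_
  rw [Finset.card_erase_of_mem hy, hn]; rfl

theorem aP_eq (t : R) (p x : ℕ) (S : Finset ℕ) :
    aP t p x S = (if S = ∅ then tw t p x else 0) + ∑ y ∈ S, tw t p y * aP t y x (S.erase y) := by
  rcases S.eq_empty_or_nonempty with rfl | h
  · simp [aP_empty]
  · rw [aP_ne t p x h, if_neg h.ne_empty, zero_add]

theorem aP_split (t : R) (x b : ℕ) (n : ℕ) : ∀ (p : ℕ) (S : Finset ℕ), S.card = n → b ∉ S →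
    aP t p x (insert b S) = sconv (aP t p b) (aP t b x) S := by
  induction n with
  | zero =>
    intro p S hS hb
    rw [Finset.card_eq_zero] at hS
    subst hS
    rw [aP_ne _ _ _ (Finset.insert_nonempty _ _)]
    simp [sconv, aP_empty]
  | succ n ih =>
    intro p S hS hb
    rw [aP_ne _ _ _ (Finset.insert_nonempty _ _), Finset.sum_insert hb, Finset.erase_insert hb]
    have h1 : sconv (aP t p b) (aP t b x) S = ∑ T ∈ S.powerset,
        ((if T = ∅ then tw t p b * aP t b x (S \ T) else 0) +
          ∑ y ∈ T, (tw t p y * aP t y b (T.erase y)) * aP t b x (S \ T)) := by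
      unfold sconv
      refine Finset.sum_congr rfl fun T _ => ?_
      rw [aP_eq t p b T, add_mul, Finset.sum_mul]
      split_ifs <;> simp
    rw [h1, Finset.sum_add_distrib,
      swapE (fun y T Q => (tw t p y * aP t y b T) * aP t b x Q) S]
    congr 1
    · rw [Finset.sum_ite_eq' S.powerset ∅ (fun T => tw t p b * aP t b x (S \ T))]
      simp
    · refine Finset.sum_congr rfl fun y hy => ?_
      have hyb : b ≠ y := fun h => hb (h ▸ hy)
      rw [Finset.erase_insert_of_ne hyb, ih y (S.erase y) (by rw [Finset.card_erase_of_mem hy]; omega)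
        (fun h => hb (Finset.mem_of_mem_erase h))]
      unfold sconv
      rw [Finset.mul_sum]
      simp only [mul_assoc]

theorem sconv_comm (f h : Finset ℕ → R) (S : Finset ℕ) : sconv f h S = sconv h f S := by
  unfold sconv
  refine Finset.sum_bij' (fun T _ => S \ T) (fun T _ => S \ T) ?_ ?_ ?_ ?_ ?_
  · intro T _; simp
  · intro T _; simp
  · intro T hT; simpa using Finset.mem_powerset.1 hT
  · intro T hT; simpa using Finset.mem_powerset.1 hT
  · intro T hT
    rw [Finset.sdiff_sdiff_eq_self (Finset.mem_powerset.1 hT), mul_comm]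

theorem aP_rot (t : R) (y b : ℕ) (T : Finset ℕ) (hb : b ∉ T) (hy : y ∉ T) :
    aP t y y (insert b T) = aP t b b (insert y T) := by
  rw [aP_split t y b _ y T rfl hb, aP_split t b y _ b T rfl hy, sconv_comm]

theorem aP_image (t : R) (e : ℕ → ℕ) (C : Finset ℕ)
    (he : ∀ a ∈ C, ∀ b ∈ C, (e a < e b ↔ a < b)) (x : ℕ) (hx : x ∈ C) (n : ℕ) :
    ∀ (p : ℕ) (S : Finset ℕ), S.card = n → p ∈ C → S ⊆ C →
      aP t (e p) (e x) (S.image e) = aP t p x S := by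
  have hinj : Set.InjOn e C := by
    intro a ha b hb h
    have h1 := he a ha b hb
    have h2 := he b hb a ha
    omega
  have htw : ∀ p ∈ C, ∀ y ∈ C, tw t (e p) (e y) = tw t p y := by
    intro p hp y hy
    unfold tw
    simp only [he y hy p hp]
  induction n with
  | zero =>
    intro p S hS hp _
    rw [Finset.card_eq_zero] at hS
    subst hS
    simp [aP_empty, htw p hp x hx]
  | succ n ih =>
    intro p S hS hp hSC
    have hne : S.Nonempty := Finset.card_pos.1 (by omega)
    rw [aP_ne _ _ _ hne, aP_ne _ _ _ (hne.image e), Finset.sum_image (hinj.mono hSC)]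
    refine Finset.sum_congr rfl fun y hy => ?_
    rw [htw p hp y (hSC hy), ← ih y (S.erase y) (by rw [Finset.card_erase_of_mem hy]; omega) (hSC hy)
      ((Finset.erase_subset _ _).trans hSC)]
    congr 2
    ext a
    simp only [Finset.mem_erase, Finset.mem_image]
    constructor
    · rintro ⟨h1, s, hs, rfl⟩
      exact ⟨s, ⟨fun h => h1 (by rw [h]), hs⟩, rfl⟩
    · rintro ⟨s, ⟨h1, hs⟩, rfl⟩
      exact ⟨fun h => h1 (hinj (hSC hs) (hSC hy) h), s, hs, rfl⟩

/-- Eulerian weights -/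
def Aj (t : R) (j : ℕ) : R := aP t 0 0 (Finset.Icc 1 j)

theorem aP_cyc (t : R) (y : ℕ) (S : Finset ℕ) (hy : y ∉ S) : aP t y y S = Aj t S.card := by
  classical
  set C := insert y S with hC
  have hne : C.Nonempty := Finset.insert_nonempty _ _
  set b := C.min' hne with hb
  have hbC : b ∈ C := Finset.min'_mem _ _
  have hyC : y ∈ C := Finset.mem_insert_self _ _
  have hS : S = C.erase y := by rw [hC, Finset.erase_insert hy]
  have hcard : C.card = S.card + 1 := Finset.card_insert_of_notMem hy
  have h1 : aP t y y S = aP t b b (C.erase b) := by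
    by_cases h : b = y
    · rw [h, hS]
    · have hbS : b ∈ S := by
        rw [hS]; exact Finset.mem_erase.2 ⟨h, hbC⟩
      have := aP_rot t y b (S.erase b) (by simp) (by simp [hy])
      rw [Finset.insert_erase hbS] at this
      rw [this]
      congr 1
      rw [hC, Finset.erase_insert_of_ne (Ne.symm h)]
  rw [h1]
  let e : ℕ → ℕ := fun x => (C.filter (· < x)).card
  have hlt : ∀ a ∈ C, ∀ c ∈ C, a < c → e a < e c := by
    intro a ha c hc hac
    apply Finset.card_lt_card
    rw [Finset.ssubset_iff_of_subset]
    · exact ⟨a, by simp [ha, hac], by simp⟩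
    · intro z hz
      simp only [Finset.mem_filter] at hz ⊢
      exact ⟨hz.1, hz.2.trans hac⟩
  have he : ∀ a ∈ C, ∀ c ∈ C, (e a < e c ↔ a < c) := by
    intro a ha c hc
    constructor
    · intro h
      by_contra hh
      rcases (not_lt.1 hh).eq_or_lt with h2 | h2
      · rw [h2] at h; exact lt_irrefl _ h
      · exact absurd (hlt c hc a ha h2) (by omega)
    · exact hlt a ha c hc
  have heb : e b = 0 := by
    simp only [e, Finset.card_eq_zero, Finset.filter_eq_empty_iff, not_lt]
    intro z hz
    exact Finset.min'_le _ _ hz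
  have hinj : Set.InjOn e C := by
    intro a ha b hb h
    have h1 := he a ha b hb
    have h2 := he b hb a ha
    omega
  have him : (C.erase b).image e = Finset.Icc 1 S.card := by
    apply Finset.eq_of_subset_of_card_le
    · intro z hz
      simp only [Finset.mem_image, Finset.mem_erase] at hz
      obtain ⟨a, ⟨hab, haC⟩, rfl⟩ := hz
      have hlt1 : b < a := lt_of_le_of_ne (Finset.min'_le _ _ haC) (Ne.symm hab)
      have := hlt b hbC a haC hlt1
      have h3 : e a < C.card := by
        apply Finset.card_lt_card
        rw [Finset.ssubset_iff_of_subset (Finset.filter_subset _ _)]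
        exact ⟨a, haC, by simp⟩
      rw [Finset.mem_Icc]
      omega
    · rw [Finset.card_image_of_injOn (hinj.mono (by simp)), Finset.card_erase_of_mem hbC]
      simp [hcard]
  rw [← aP_image t e C he b hbC _ b (C.erase b) rfl hbC (Finset.erase_subset _ _), heb, him, Aj]

end Alg

section Alg2

set_option linter.unusedSectionVars false

variable {R : Type*} [CommRing R] [Algebra ℚ R]

/-- exponential generating function of the Eulerian weights -/
noncomputable def Aser (t : R) : PowerSeries R :=
  PowerSeries.mk fun j => ((j.factorial : ℚ)⁻¹) • Aj t j

/-- `n! [u^n] A(u)^k` -/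
noncomputable def Fnk (t : R) (n k : ℕ) : R :=
  (n.factorial : ℚ) • PowerSeries.coeff n (Aser t ^ k)

theorem Fnk_succ (t : R) (n k : ℕ) :
    Fnk t n (k + 1) = ∑ j ∈ Finset.range (n + 1), (n.choose j : ℚ) • (Aj t j * Fnk t (n - j) k) := by
  unfold Fnk
  rw [pow_succ', PowerSeries.coeff_mul, Finset.Nat.sum_antidiagonal_eq_sum_range_succ_mk,
    Finset.smul_sum]
  refine Finset.sum_congr rfl fun j hj => ?_
  have hj' : j ≤ n := by simpa [Nat.lt_succ_iff] using hj
  simp only [Aser, PowerSeries.coeff_mk, mul_smul_comm, smul_mul_assoc, smul_smul]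
  congr 1
  rw [← Nat.choose_mul_factorial_mul_factorial hj']
  have := Nat.factorial_ne_zero j
  push_cast
  field_simp

theorem Fnk_one (t : R) (n : ℕ) : Fnk t n 1 = Aj t n := by
  unfold Fnk
  have := Nat.factorial_ne_zero n
  simp only [pow_one, Aser, PowerSeries.coeff_mk, smul_smul]
  rw [mul_inv_cancel₀ (by exact_mod_cast this), one_smul]

theorem Fnk_deriv (t : R) (n k : ℕ) :
    Fnk t (n + 1) (k + 1) = ((k : ℚ) + 1) •
      ∑ j ∈ Finset.range (n + 1), (n.choose j : ℚ) • (Aj t (j + 1) * Fnk t (n - j) k) := by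
  have h := congrArg (PowerSeries.coeff n) (PowerSeries.derivative_pow (Aser t) (k + 1))
  rw [PowerSeries.coeff_derivative] at h
  have h2 : Fnk t (n + 1) (k + 1) = (n.factorial : ℚ) •
      (PowerSeries.coeff (n + 1) (Aser t ^ (k + 1)) * ((n : R) + 1)) := by
    unfold Fnk
    rw [Nat.factorial_succ]
    simp only [Algebra.smul_def]
    push_cast
    ring
  rw [h2, h]
  have h3 : ((k + 1 : ℕ) : PowerSeries R) * Aser t ^ (k + 1 - 1) * (PowerSeries.derivative R) (Aser t) =
     PowerSeries.C ((k : R) + 1) * ((PowerSeries.derivative R) (Aser t) * Aser t ^ k) := by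
    simp only [Nat.add_sub_cancel, map_add, map_one, map_natCast]
    push_cast
    ring
  rw [h3, PowerSeries.coeff_C_mul, PowerSeries.coeff_mul,
    Finset.Nat.sum_antidiagonal_eq_sum_range_succ_mk]
  have h4 : ((k : R) + 1) = algebraMap ℚ R ((k : ℚ) + 1) := by simp
  rw [h4, ← Algebra.smul_def, smul_comm]
  congr 1
  rw [Finset.smul_sum]
  refine Finset.sum_congr rfl fun j hj => ?_
  have hj' : j ≤ n := by simpa [Nat.lt_succ_iff] using hj
  have h5 : ((j : R) + 1) = algebraMap ℚ R ((j : ℚ) + 1) := by simp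
  unfold Fnk
  rw [PowerSeries.coeff_derivative, h5, mul_comm (PowerSeries.coeff (j + 1) (Aser t)),
    ← Algebra.smul_def]
  simp only [Aser, PowerSeries.coeff_mk, mul_smul_comm, smul_mul_assoc, smul_smul]
  congr 1
  rw [← Nat.choose_mul_factorial_mul_factorial hj', Nat.factorial_succ]
  have := Nat.factorial_ne_zero j
  push_cast
  field_simp

/-- `r/(r+s) F(n,r+s)` -/
noncomputable def Ev (t : R) (n r s : ℕ) : R :=
  if r + s = 0 then (if n = 0 then 1 else 0) else ((r : ℚ) / ((r : ℚ) + s)) • Fnk t n (r + s)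

/-- set version of `Ev` -/
noncomputable def ES (c : ℕ → ℕ) (t : R) (r : ℕ) (S : Finset ℕ) : R :=
  Ev t S.card r (∑ y ∈ S, c y)

theorem ES_zero_empty (c : ℕ → ℕ) (t : R) : ES c t 0 ∅ = 1 := by simp [ES, Ev]

theorem ES_zero_ne (c : ℕ → ℕ) (t : R) (S : Finset ℕ) (hS : S ≠ ∅) : ES c t 0 S = 0 := by
  unfold ES Ev
  have : S.card ≠ 0 := by simpa using hS
  split_ifs <;> simp_all

theorem sum_pow_card (f : ℕ → R) (S : Finset ℕ) :
    ∑ T ∈ S.powerset, f T.card = ∑ j ∈ Finset.range (S.card + 1), (S.card.choose j : ℚ) • f j := by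
  rw [Finset.sum_powerset_apply_card]
  refine Finset.sum_congr rfl fun j _ => ?_
  rw [Nat.cast_smul_eq_nsmul]

theorem sum_pow_sig (c : ℕ → ℕ) (f : ℕ → R) (S : Finset ℕ) (n : ℕ) (hn : S.card = n + 1) :
    ∑ T ∈ S.powerset, ((∑ y ∈ T, c y : ℕ) : ℚ) • f T.card =
      ((∑ y ∈ S, c y : ℕ) : ℚ) • ∑ j ∈ Finset.range (n + 1), (n.choose j : ℚ) • f (j + 1) := by
  have h1 : ∀ T ∈ S.powerset, ((∑ y ∈ T, c y : ℕ) : ℚ) • f T.card =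
      ∑ y ∈ T, (c y : ℚ) • f ((T.erase y).card + 1) := by
    intro T _
    push_cast
    rw [Finset.sum_smul]
    refine Finset.sum_congr rfl fun y hy => ?_
    rw [Finset.card_erase_add_one hy]
  rw [Finset.sum_congr rfl h1, swapE (fun y T _ => (c y : ℚ) • f (T.card + 1)) S]
  push_cast
  rw [Finset.sum_smul]
  refine Finset.sum_congr rfl fun y hy => ?_
  have hc : (S.erase y).card = n := by rw [Finset.card_erase_of_mem hy]; omega
  rw [← Finset.smul_sum, sum_pow_card (fun j => f (j + 1)), hc]

theorem ES_rec (c : ℕ → ℕ) (t : R) (r : ℕ) (S : Finset ℕ) :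
    ES c t (r + 1) S = ∑ T ∈ S.powerset, Aj t T.card * ES c t (r + ∑ y ∈ T, c y) (S \ T) := by
  have hsig : ∀ T ∈ S.powerset, ∑ y ∈ T, c y + ∑ y ∈ S \ T, c y = ∑ y ∈ S, c y := by
    intro T hT
    rw [add_comm]
    exact Finset.sum_sdiff (Finset.mem_powerset.1 hT)
  by_cases hk : r + ∑ y ∈ S, c y = 0
  · have hr : r = 0 := by omega
    have hs : ∑ y ∈ S, c y = 0 := by omega
    subst hr
    rw [Finset.sum_eq_single S]
    · simp [ES, Ev, hs, Fnk_one]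
    · intro T hT hne
      have h0 := hsig T hT
      have h1 : ∑ y ∈ T, c y = 0 := by omega
      rw [h1, ES_zero_ne, mul_zero]
      intro h
      exact hne (Finset.Subset.antisymm (Finset.mem_powerset.1 hT) (Finset.sdiff_eq_empty_iff_subset.1 h))
    · simp
  · set k := r + ∑ y ∈ S, c y with hkdef
    have hkq : (k : ℚ) ≠ 0 := by exact_mod_cast hk
    have hk1 : (k : ℚ) + 1 ≠ 0 := by positivity
    let f : ℕ → R := fun j => Aj t j * Fnk t (S.card - j) k
    have h1 : ∀ T ∈ S.powerset, Aj t T.card * ES c t (r + ∑ y ∈ T, c y) (S \ T) =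
        ((r : ℚ) / k) • f T.card + (1 / (k : ℚ)) • (((∑ y ∈ T, c y : ℕ) : ℚ) • f T.card) := by
      intro T hT
      have h0 := hsig T hT
      have h2 : r + ∑ y ∈ T, c y + ∑ y ∈ S \ T, c y = k := by omega
      have h2q : (((r + ∑ y ∈ T, c y : ℕ) : ℚ) + ((∑ y ∈ S \ T, c y : ℕ) : ℚ)) = k := by
        exact_mod_cast h2
      unfold ES Ev
      rw [if_neg (by omega), h2, h2q, Finset.card_sdiff_of_subset (Finset.mem_powerset.1 hT)]
      simp only [f, smul_smul, ← add_smul, mul_smul_comm]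
      congr 1
      push_cast
      field_simp
    rw [Finset.sum_congr rfl h1, Finset.sum_add_distrib, ← Finset.smul_sum, ← Finset.smul_sum,
      sum_pow_card f S, ← Fnk_succ]
    have h3 : ∑ T ∈ S.powerset, ((∑ y ∈ T, c y : ℕ) : ℚ) • f T.card =
        (((∑ y ∈ S, c y : ℕ) : ℚ) / (k + 1)) • Fnk t S.card (k + 1) := by
      rcases S.eq_empty_or_nonempty with rfl | hne
      · simp
      · obtain ⟨n, hn⟩ : ∃ n, S.card = n + 1 := ⟨S.card - 1, by have := hne.card_pos; omega⟩
        rw [sum_pow_sig c f S n hn, hn, Fnk_deriv, smul_smul, div_mul_cancel₀ _ hk1]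
        congr 1
        refine Finset.sum_congr rfl fun j hj => ?_
        simp only [f, hn]
        rw [show n + 1 - (j + 1) = n - j by omega]
    rw [h3]
    unfold ES Ev
    rw [if_neg (by omega)]
    have h4 : r + 1 + ∑ y ∈ S, c y = k + 1 := by omega
    have h5 : (((r + 1 : ℕ) : ℚ) + ((∑ y ∈ S, c y : ℕ) : ℚ)) = k + 1 := by exact_mod_cast h4
    have h6 : ((∑ y ∈ S, c y : ℕ) : ℚ) = k - r := by rw [hkdef]; push_cast; ring
    rw [h4, h5, h6, smul_smul, ← add_smul]
    congr 1
    push_cast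
    field_simp
    ring

theorem ES_conv (c : ℕ → ℕ) (t : R) (n : ℕ) : ∀ (S : Finset ℕ), S.card = n → ∀ r s : ℕ,
    sconv (ES c t r) (ES c t s) S = ES c t (r + s) S := by
  induction n using Nat.strong_induction_on with
  | _ n ih =>
    intro S hS r s
    induction r with
    | zero =>
      rw [sconv_one _ _ _ (ES_zero_empty c t) (fun T _ h => ES_zero_ne c t T h), zero_add]
    | succ r ihr =>
      have h1 : sconv (ES c t (r + 1)) (ES c t s) S =
          ∑ V ∈ S.powerset, ∑ T ∈ V.powerset,
            Aj t T.card * ES c t (r + ∑ y ∈ T, c y) (V \ T) * ES c t s (S \ V) := by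
        unfold sconv
        refine Finset.sum_congr rfl fun V _ => ?_
        rw [ES_rec, Finset.sum_mul]
      rw [h1, tri1 (fun T W Q => Aj t T.card * ES c t (r + ∑ y ∈ T, c y) W * ES c t s Q) S,
        show r + 1 + s = (r + s) + 1 by ring, ES_rec]
      refine Finset.sum_congr rfl fun T hT => ?_
      have h2 : sconv (ES c t (r + ∑ y ∈ T, c y)) (ES c t s) (S \ T) =
          ES c t (r + s + ∑ y ∈ T, c y) (S \ T) := by
        rcases T.eq_empty_or_nonempty with rfl | hne
        · simpa using ihr
        · rw [show r + s + ∑ y ∈ T, c y = (r + ∑ y ∈ T, c y) + s by ring]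
          refine ih _ ?_ (S \ T) rfl _ _
          rw [Finset.card_sdiff_of_subset (Finset.mem_powerset.1 hT)]
          have := hne.card_pos
          have := Finset.card_le_card (Finset.mem_powerset.1 hT)
          omega
      rw [← h2, sconv, Finset.mul_sum]
      simp only [mul_assoc]

/-- weighted sum for one slot -/
noncomputable def bP (c : ℕ → ℕ) (t : R) (p x : ℕ) (S : Finset ℕ) : R :=
  ∑ T ∈ S.powerset, aP t p x T * ES c t (∑ y ∈ T, c y) (S \ T)

theorem bP_self (c : ℕ → ℕ) (t : R) (y : ℕ) (S : Finset ℕ) (hy : y ∉ S) :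
    bP c t y y S = ES c t 1 S := by
  unfold bP
  rw [show (1 : ℕ) = 0 + 1 from rfl, ES_rec]
  refine Finset.sum_congr rfl fun T hT => ?_
  rw [aP_cyc t y T (fun h => hy (Finset.mem_powerset.1 hT h)), zero_add]

theorem bP_eq (c : ℕ → ℕ) (t : R) (p x : ℕ) (S : Finset ℕ) :
    bP c t p x S = (if S = ∅ then tw t p x else 0) +
      ∑ y ∈ S, tw t p y * sconv (ES c t (c y)) (bP c t y x) (S.erase y) := by
  have h1 : bP c t p x S = ∑ T ∈ S.powerset,
      ((if T = ∅ then tw t p x * ES c t 0 S else 0) +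
        ∑ y ∈ T, (tw t p y * aP t y x (T.erase y)) *
          ES c t (c y + ∑ z ∈ T.erase y, c z) (S \ T)) := by
    unfold bP
    refine Finset.sum_congr rfl fun T _ => ?_
    rw [aP_eq t p x T, add_mul, Finset.sum_mul]
    congr 1
    · split_ifs with h
      · subst h; simp
      · simp
    · refine Finset.sum_congr rfl fun y hy => ?_
      rw [Finset.add_sum_erase _ _ hy]
  rw [h1, Finset.sum_add_distrib,
    swapE (fun y T Q => (tw t p y * aP t y x T) * ES c t (c y + ∑ z ∈ T, c z) Q) S]
  congr 1
  · rw [Finset.sum_ite_eq' S.powerset ∅ (fun T => tw t p x * ES c t 0 S)]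
    rw [if_pos (by simp)]
    split_ifs with h
    · subst h; rw [ES_zero_empty, mul_one]
    · rw [ES_zero_ne _ _ _ h, mul_zero]
  · refine Finset.sum_congr rfl fun y hy => ?_
    set V := S.erase y
    have h2 : sconv (ES c t (c y)) (bP c t y x) V = ∑ W ∈ V.powerset, ∑ T ∈ (V \ W).powerset,
        aP t y x T * (ES c t (c y) W * ES c t (∑ z ∈ T, c z) ((V \ T) \ W)) := by
      unfold sconv bP
      refine Finset.sum_congr rfl fun W _ => ?_
      rw [Finset.mul_sum]
      refine Finset.sum_congr rfl fun T _ => ?_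
      rw [sdiff_right_comm]
      ring
    rw [h2, tri2 (fun W T => aP t y x T * (ES c t (c y) W * ES c t (∑ z ∈ T, c z) ((V \ T) \ W))) V,
      Finset.mul_sum]
    refine Finset.sum_congr rfl fun T hT => ?_
    rw [← Finset.mul_sum]
    have := ES_conv c t _ (V \ T) rfl (c y) (∑ z ∈ T, c z)
    rw [sconv] at this
    rw [this, mul_assoc]

/-- fuel version of the automaton sum -/
def PhiF (m : ℕ → ℕ) (t : R) : ℕ → ℕ → List ℕ → Finset ℕ → R
  | 0, _, L, U => if L = [] ∧ U = ∅ then 1 else 0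
  | _ + 1, _, [], _ => 0
  | N + 1, p, x :: L, U => tw t p x * PhiF m t N x L U +
      ∑ y ∈ U, tw t p y * PhiF m t N y (List.replicate (m y - 1) y ++ x :: L) (U.erase y)

/-- automaton sum -/
def Phi (m : ℕ → ℕ) (t : R) (p : ℕ) (L : List ℕ) (U : Finset ℕ) : R :=
  PhiF m t (L.length + ∑ y ∈ U, m y) p L U

theorem Phi_nil (m : ℕ → ℕ) (t : R) (p : ℕ) : Phi m t p [] ∅ = 1 := by
  simp [Phi, PhiF]

theorem Phi_nil_ne (m : ℕ → ℕ) (t : R) (p : ℕ) (U : Finset ℕ) (hU : U ≠ ∅) :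
    Phi m t p [] U = 0 := by
  unfold Phi
  cases h : ([] : List ℕ).length + ∑ y ∈ U, m y with
  | zero => simp [PhiF, hU]
  | succ n => simp [PhiF]

theorem len_step (m : ℕ → ℕ) (x : ℕ) (L : List ℕ) (U : Finset ℕ) (hU : ∀ y ∈ U, 1 ≤ m y) (y : ℕ)
    (hy : y ∈ U) : (List.replicate (m y - 1) y ++ x :: L).length + ∑ z ∈ U.erase y, m z =
      L.length + ∑ z ∈ U, m z := by
  rw [← Finset.add_sum_erase U m hy]
  have := hU y hy
  simp
  omega

theorem Phi_cons (m : ℕ → ℕ) (t : R) (p x : ℕ) (L : List ℕ) (U : Finset ℕ)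
    (hU : ∀ y ∈ U, 1 ≤ m y) :
    Phi m t p (x :: L) U = tw t p x * Phi m t x L U +
      ∑ y ∈ U, tw t p y * Phi m t y (List.replicate (m y - 1) y ++ x :: L) (U.erase y) := by
  unfold Phi
  rw [show (x :: L).length + ∑ y ∈ U, m y = (L.length + ∑ y ∈ U, m y) + 1 by simp; ring, PhiF]
  congr 1
  refine Finset.sum_congr rfl fun y hy => ?_
  rw [len_step m x L U hU y hy]

theorem Phi_conv (m : ℕ → ℕ) (t : R) (n : ℕ) : ∀ (U : Finset ℕ), U.card = n →
    (∀ y ∈ U, 1 ≤ m y) → ∀ (p x : ℕ) (L : List ℕ),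
    Phi m t p (x :: L) U = sconv (bP (fun y => m y - 1) t p x) (Phi m t x L) U := by
  induction n using Nat.strong_induction_on with
  | _ n ih =>
    intro U hn hU p x L
    set c : ℕ → ℕ := fun y => m y - 1 with hc
    rw [Phi_cons m t p x L U hU]
    have hb : sconv (bP c t p x) (Phi m t x L) U = ∑ S ∈ U.powerset,
        ((if S = ∅ then tw t p x * Phi m t x L U else 0) + ∑ y ∈ S, (tw t p y *
          sconv (ES c t (c y)) (bP c t y x) (S.erase y)) * Phi m t x L (U \ S)) := by
      unfold sconv
      refine Finset.sum_congr rfl fun S _ => ?_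
      rw [bP_eq c t p x S, add_mul, Finset.sum_mul]
      congr 1
      split_ifs with h
      · subst h; simp
      · simp
    rw [hb, Finset.sum_add_distrib, swapE (fun y S Q => (tw t p y *
          sconv (ES c t (c y)) (bP c t y x) S) * Phi m t x L Q) U]
    congr 1
    · rw [Finset.sum_ite_eq' U.powerset ∅ (fun T => tw t p x * Phi m t x L U)]
      rw [if_pos (by simp)]
    · refine Finset.sum_congr rfl fun y hy => ?_
      have key : ∀ (d : ℕ) (V : Finset ℕ), V ⊆ U.erase y →
          Phi m t y (List.replicate d y ++ x :: L) V =
            sconv (ES c t d) (Phi m t y (x :: L)) V := by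
        intro d
        induction d with
        | zero =>
          intro V _
          rw [sconv_one _ _ _ (ES_zero_empty c t) (fun T _ h => ES_zero_ne c t T h)]
          simp
        | succ d ihd =>
          intro V hV
          have hVU : V.card < n := by
            have := Finset.card_le_card hV
            have h3 := Finset.card_erase_lt_of_mem hy
            omega
          rw [List.replicate_succ, List.cons_append,
            ih V.card hVU V rfl (fun z hz => hU z (Finset.mem_of_mem_erase (hV hz)))]
          have : sconv (bP c t y y) (Phi m t y (List.replicate d y ++ x :: L)) V =
              sconv (ES c t 1) (sconv (ES c t d) (Phi m t y (x :: L))) V := by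
            apply sconv_congr
            · intro T hT
              exact bP_self c t y T (fun h => by simpa using hV (hT h))
            · intro T hT
              exact ihd T (hT.trans hV)
          rw [this, ← sconv_assoc]
          apply sconv_congr
          · intro T _
            rw [ES_conv c t _ T rfl, add_comm]
          · intro T _; rfl
      have h2 : Phi m t y (List.replicate (m y - 1) y ++ x :: L) (U.erase y) =
          sconv (sconv (ES c t (c y)) (bP c t y x)) (Phi m t x L) (U.erase y) := by
        rw [key (m y - 1) _ (Finset.Subset.refl _), sconv_assoc]
        apply sconv_congr
        · intro T _; rfl
        · intro T hT
          have h3 := Finset.card_erase_lt_of_mem hy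
          have := Finset.card_le_card hT
          exact ih T.card (by omega) T rfl (fun z hz => hU z (Finset.mem_of_mem_erase (hT hz))) y x L
      rw [h2]
      conv_lhs => rw [sconv, Finset.mul_sum]
      simp only [mul_assoc]

theorem Phi_main (m : ℕ → ℕ) (t : R) (U : Finset ℕ) (hU : ∀ y ∈ U, 1 ≤ m y) (h0 : 0 ∉ U) :
    Phi m t 0 [0] U = ES (fun y => m y - 1) t 1 U := by
  rw [Phi_conv m t _ U rfl hU, sconv_comm,
    sconv_one _ _ _ (Phi_nil m t 0) (fun T _ h => Phi_nil_ne m t 0 T h), bP_self _ _ _ _ h0]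

theorem Fnk_zero (t : R) (n : ℕ) : Fnk t n 0 = if n = 0 then 1 else 0 := by
  unfold Fnk
  rw [pow_zero, PowerSeries.coeff_one]
  split_ifs with h
  · subst h; simp
  · simp

/-- recursion in set form -/
theorem Fnk_sconv (t : R) (k : ℕ) (S : Finset ℕ) :
    Fnk t S.card (k + 1) = sconv (fun T => Aj t T.card) (fun T => Fnk t T.card k) S := by
  unfold sconv
  rw [Fnk_succ, ← sum_pow_card (fun j => Aj t j * Fnk t (S.card - j) k)]
  refine Finset.sum_congr rfl fun T hT => ?_
  simp only [Finset.card_sdiff_of_subset (Finset.mem_powerset.1 hT)]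

end Alg2

section Words

variable {R : Type*} [CommRing R]

/-- weight of a word preceded by `p` -/
def wt (t : R) : ℕ → List ℕ → R
  | _, [] => 1
  | p, z :: w => tw t p z * wt t z w

theorem wt_eq (t : R) (l : List ℕ) : ∀ p : ℕ,
    t ^ ((Finset.range l.length).filter fun i => (p :: l).getD (i + 1) 0 < (p :: l).getD i 0).card
      = wt t p l := by
  induction l with
  | nil => intro p; simp [wt]
  | cons z l ih =>
    intro p
    rw [wt, ← ih z, Finset.card_filter, Finset.card_filter, List.length_cons,
      Finset.sum_range_succ', pow_add, mul_comm]
    congr 1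
    simp only [tw, List.getD_cons_succ, List.getD_cons_zero]
    split_ifs <;> simp

theorem pow_desN (t : R) (w : List ℕ) : t ^ desN w = wt t 0 (w ++ [0]) := by
  rw [← wt_eq, desN]
  simp only [pad, List.length_append, List.length_singleton]
  congr

/-- words accepted by the stack automaton -/
def Wd (m : ℕ → ℕ) : ℕ → List ℕ → Finset ℕ → Finset (List ℕ)
  | 0, L, U => if L = [] ∧ U = ∅ then {[]} else ∅
  | _ + 1, [], _ => ∅
  | N + 1, x :: L, U => (Wd m N L U).image (fun w => x :: w) ∪
      U.biUnion fun y => (Wd m N (List.replicate (m y - 1) y ++ x :: L) (U.erase y)).image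
        (fun w => y :: w)

theorem Wd_sum (m : ℕ → ℕ) (t : R) (N : ℕ) : ∀ (p : ℕ) (L : List ℕ) (U : Finset ℕ),
    (∀ z ∈ L, z ∉ U) → ∑ w ∈ Wd m N L U, wt t p w = PhiF m t N p L U := by
  induction N with
  | zero =>
    intro p L U _
    simp only [Wd, PhiF]
    split_ifs <;> simp [wt]
  | succ N ih =>
    intro p L U hLU
    cases L with
    | nil => simp [Wd, PhiF]
    | cons x L =>
      have hinj : ∀ (y : ℕ) (s : Set (List ℕ)), Set.InjOn (fun w => y :: w) s := by
        intro y s a _ b _ h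
        simpa using h
      rw [Wd, PhiF, Finset.sum_union, Finset.sum_image (hinj _ _), Finset.sum_biUnion]
      · congr 1
        · simp only [wt, ← Finset.mul_sum]
          rw [ih x L U (fun z hz => hLU z (List.mem_cons_of_mem _ hz))]
        · refine Finset.sum_congr rfl fun y hy => ?_
          rw [Finset.sum_image (hinj _ _)]
          simp only [wt, ← Finset.mul_sum]
          rw [ih]
          intro z hz
          rw [List.mem_append] at hz
          rcases hz with hz | hz
          · rw [List.eq_of_mem_replicate hz]; simp
          · exact fun h => hLU z hz (Finset.mem_of_mem_erase h)
      · intro y _ y' _ hne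
        rw [Function.onFun, Finset.disjoint_left]
        intro w h1 h2
        simp only [Finset.mem_image] at h1 h2
        obtain ⟨a, _, rfl⟩ := h1
        obtain ⟨b, _, h⟩ := h2
        simp only [List.cons.injEq] at h
        exact hne h.1.symm
      · rw [Finset.disjoint_left]
        intro w h1 h2
        simp only [Finset.mem_image, Finset.mem_biUnion] at h1 h2
        obtain ⟨a, _, rfl⟩ := h1
        obtain ⟨y, hy, b, _, h⟩ := h2
        simp only [List.cons.injEq] at h
        exact hLU x (by simp) (h.1 ▸ hy)

/-- noncrossing words -/
def NC (w : List ℕ) : Prop := ∀ a b : ℕ, a ≠ b → ¬ List.Sublist [a, b, a, b] w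

theorem IsQS_iff (w : List ℕ) : IsQS w ↔ NC w := by
  unfold IsQS NC
  constructor
  · intro h a b hab hs
    apply h
    obtain ⟨f, hf⟩ := List.sublist_iff_exists_orderEmbedding_getElem?_eq.1 hs
    have h0 := hf 0
    have h1 := hf 1
    have h2 := hf 2
    have h3 := hf 3
    simp at h0 h1 h2 h3
    refine ⟨f 0, f 1, f 2, f 3, by simp, by simp, by simp, ?_, ?_, ?_, ?_⟩
    · by_contra hh
      rw [List.getElem?_eq_none (by omega)] at h3
      simp at h3
    · simp [List.getD_eq_getElem?_getD, ← h0, ← h2]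
    · simp [List.getD_eq_getElem?_getD, ← h1, ← h3]
    · simpa [List.getD_eq_getElem?_getD, ← h0, ← h1] using hab
  · rintro h ⟨i, j, k, l, hij, hjk, hkl, hl, h1, h2, h3⟩
    apply h _ _ h3
    have hi : i < w.length := by omega
    have hj : j < w.length := by omega
    have hk : k < w.length := by omega
    have hs : List.Sublist [w[i], w[j], w[k], w[l]] w := by
      have e1 : List.Sublist [w[i]] (w.take j) := by
        rw [List.singleton_sublist, List.mem_take_iff_getElem]
        exact ⟨i, by omega, rfl⟩
      have e2 : List.Sublist [w[j]] ((w.take k).drop j) := by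
        rw [List.singleton_sublist, List.mem_drop_iff_getElem]
        exact ⟨0, by simp; omega, by simp⟩
      have e3 : List.Sublist [w[k]] ((w.take l).drop k) := by
        rw [List.singleton_sublist, List.mem_drop_iff_getElem]
        exact ⟨0, by simp; omega, by simp⟩
      have e4 : List.Sublist [w[l]] (w.drop l) := by
        rw [List.singleton_sublist, List.mem_drop_iff_getElem]
        exact ⟨0, by simp; omega, by simp⟩
      have := ((e1.append e2).append e3).append e4
      have hw : w.take j ++ (w.take k).drop j ++ (w.take l).drop k ++ w.drop l = w := by
        have q1 : w.take j ++ (w.take k).drop j = w.take k := by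
          conv_rhs => rw [← List.take_append_drop j (w.take k)]
          rw [List.take_take, min_eq_left (by omega)]
        have q2 : w.take k ++ (w.take l).drop k = w.take l := by
          conv_rhs => rw [← List.take_append_drop k (w.take l)]
          rw [List.take_take, min_eq_left (by omega)]
        rw [q1, q2, List.take_append_drop]
      rw [hw] at this
      simpa using this
    rw [List.getD_eq_getElem _ _ hi, List.getD_eq_getElem _ _ hk] at h1
    rw [List.getD_eq_getElem _ _ hj, List.getD_eq_getElem _ _ hl] at h2
    rw [List.getD_eq_getElem _ _ hi, List.getD_eq_getElem _ _ hj]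
    rw [← h1, ← h2] at hs
    exact hs

theorem sub_collapse (z : ℕ) (v : List ℕ) : ∀ (u l : List ℕ), l.IsChain (· ≠ ·) →
    List.Sublist l (u ++ z :: z :: v) → List.Sublist l (u ++ z :: v) := by
  intro u
  induction u with
  | nil =>
    intro l hl hs
    simp only [List.nil_append] at hs ⊢
    cases hs with
    | cons _ h => exact h
    | cons_cons _ h =>
      rename_i l'
      cases h with
      | cons _ h => exact h.cons_cons _
      | cons_cons _ h =>
        simp at hl
  | cons a u ih =>
    intro l hl hs
    rw [List.cons_append] at hs ⊢
    cases hs with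
    | cons _ h => exact (ih _ hl h).cons _
    | cons_cons _ h => exact (ih _ hl.tail h).cons_cons _

theorem NC_mono {u v : List ℕ} (h : List.Sublist u v) (hv : NC v) : NC u :=
  fun a b hab hs => hv a b hab (hs.trans h)

theorem NC_collapse (u v : List ℕ) (z : ℕ) : NC (u ++ z :: z :: v) ↔ NC (u ++ z :: v) := by
  constructor
  · apply NC_mono
    exact List.Sublist.append_left (List.sublist_cons_self _ _) _
  · intro h a b hab hs
    refine h a b hab (sub_collapse z v u _ ?_ hs)
    simp [hab, hab.symm]

theorem NC_rep (u v : List ℕ) (z c : ℕ) :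
    NC (u ++ (List.replicate (c + 1) z ++ v)) ↔ NC (u ++ z :: v) := by
  induction c with
  | zero => simp
  | succ c ih =>
    rw [← ih, List.replicate_succ, List.replicate_succ]
    simp only [List.cons_append]
    rw [NC_collapse]

theorem NC_remove (u v : List ℕ) (z : ℕ) (hu : z ∉ u) (hv : z ∉ v) :
    NC (u ++ z :: v) ↔ NC (u ++ v) := by
  constructor
  · apply NC_mono
    exact List.Sublist.append_left (List.sublist_cons_self _ _) _
  · intro h a b hab hs
    have hc : (u ++ z :: v).count z = 1 := by
      simp [List.count_eq_zero.2 hu, List.count_eq_zero.2 hv]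
    have hza : z ∉ [a, b, a, b] := by
      intro hz
      have h1 := hs.count_le z
      rw [hc] at h1
      simp at hz
      have hz' : z = a ∨ z = b := by tauto
      rcases hz' with rfl | rfl
      · simp [hab.symm] at h1
      · simp [hab] at h1
    apply h a b hab
    rw [List.sublist_append_iff] at hs ⊢
    obtain ⟨l1, l2, h1, h2, h3⟩ := hs
    refine ⟨l1, l2, h1, h2, ?_⟩
    cases h3 with
    | cons _ h => exact h
    | cons_cons _ h => exact absurd (by rw [h1]; simp) hza

/-- grouped lists -/
def Gr : List ℕ → Prop
  | [] => True
  | x :: L => (x ∈ L → L.head? = some x) ∧ Gr L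

theorem Gr_rep (z : ℕ) (L : List ℕ) (hz : z ∉ L) (hL : Gr L) (c : ℕ) :
    Gr (List.replicate c z ++ L) := by
  induction c with
  | zero => simpa
  | succ c ih =>
    rw [List.replicate_succ, List.cons_append]
    refine ⟨?_, ih⟩
    intro h
    cases c with
    | zero => simp at h; exact absurd h hz
    | succ c => simp [List.replicate_succ]

/-- letter counts -/
def Cnt (m : ℕ → ℕ) (L : List ℕ) (U : Finset ℕ) (w : List ℕ) : Prop :=
  ∀ z, w.count z = L.count z + if z ∈ U then m z else 0

theorem mem_Wd_cons (m : ℕ → ℕ) (N x z : ℕ) (L w : List ℕ) (U : Finset ℕ) :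
    z :: w ∈ Wd m (N + 1) (x :: L) U ↔ (z = x ∧ w ∈ Wd m N L U) ∨
      (z ∈ U ∧ w ∈ Wd m N (List.replicate (m z - 1) z ++ x :: L) (U.erase z)) := by
  simp only [Wd, Finset.mem_union, Finset.mem_image, Finset.mem_biUnion, List.cons.injEq]
  constructor
  · rintro (⟨a, h1, rfl, rfl⟩ | ⟨y, hy, a, h, rfl, rfl⟩)
    · exact Or.inl ⟨rfl, h1⟩
    · exact Or.inr ⟨hy, h⟩
  · rintro (⟨rfl, h⟩ | ⟨hy, h⟩)
    · exact Or.inl ⟨w, h, rfl, rfl⟩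
    · exact Or.inr ⟨z, hy, w, h, rfl, rfl⟩

theorem nil_mem_Wd (m : ℕ → ℕ) (N x : ℕ) (L : List ℕ) (U : Finset ℕ) :
    [] ∉ Wd m (N + 1) (x :: L) U := by
  simp [Wd]

theorem getLast?_cons_ne {z : ℕ} {w : List ℕ} (h : w ≠ []) : (z :: w).getLast? = w.getLast? := by
  cases w with
  | nil => exact absurd rfl h
  | cons a w => simp [List.getLast?_cons_cons]

theorem mem_Wd (m : ℕ → ℕ) (N : ℕ) : ∀ (L : List ℕ) (U : Finset ℕ),
    N = L.length + ∑ y ∈ U, m y → (∀ y ∈ U, 1 ≤ m y) → (∀ z ∈ L, z ∉ U) → Gr L →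
    ∀ w, w ∈ Wd m N L U ↔ Cnt m L U w ∧ NC (L.reverse ++ w) ∧ w.getLast? = L.getLast? := by
  induction N with
  | zero =>
    intro L U hN hU _ _ w
    have hL : L = [] := List.length_eq_zero_iff.1 (by omega)
    have hU0 : U = ∅ := by
      by_contra hne
      obtain ⟨y, hy⟩ := Finset.nonempty_iff_ne_empty.2 hne
      have := Finset.single_le_sum (f := m) (fun i _ => Nat.zero_le _) hy
      have := hU y hy
      omega
    subst hL hU0
    simp only [Wd, and_self, if_true, Finset.mem_singleton]
    constructor
    · rintro rfl
      refine ⟨fun z => by simp, ?_, by simp⟩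
      intro a b _ h
      simp at h
    · rintro ⟨_, _, h⟩
      simpa using h
  | succ N ih =>
    intro L U hN hU hLU hG w
    cases L with
    | nil =>
      simp only [Wd, Finset.notMem_empty, false_iff]
      rintro ⟨h1, _, h⟩
      have hw : w = [] := by simpa using h
      subst hw
      have : U.Nonempty := by
        rw [Finset.nonempty_iff_ne_empty]
        rintro rfl
        simp at hN
      obtain ⟨y, hy⟩ := this
      have h2 := h1 y
      have := hU y hy
      simp [hy] at h2
      omega
    | cons x L =>
      cases w with
      | nil =>
        simp only [nil_mem_Wd, false_iff]
        rintro ⟨h, _⟩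
        have := h x
        simp at this
        omega
      | cons z w =>
        rw [mem_Wd_cons]
        have hxU : x ∉ U := hLU x (by simp)
        by_cases hzx : z = x
        · subst hzx
          simp only [true_and, hxU, false_and, or_false]
          rw [ih L U (by simp at hN; omega) hU (fun y hy => hLU y (List.mem_cons_of_mem _ hy)) hG.2 w]
          have hcnt : Cnt m (z :: L) U (z :: w) ↔ Cnt m L U w := by
            unfold Cnt
            refine forall_congr' fun y => ?_
            simp only [List.count_cons]
            split_ifs <;> omega
          rw [hcnt]
          refine and_congr_right fun hc => ?_
          have hcz : w.count z = L.count z := by simpa [hxU] using hc z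
          apply and_congr
          · rw [List.reverse_cons, List.append_assoc, List.singleton_append, NC_collapse]
            by_cases hzL : z ∈ L
            · have := hG.1 hzL
              cases L with
              | nil => simp at hzL
              | cons a L =>
                simp at this
                subst this
                simp only [List.reverse_cons, List.append_assoc, List.singleton_append]
                rw [NC_collapse]
            · rw [NC_remove]
              · simpa using hzL
              · rw [← List.count_eq_zero, hcz]; exact List.count_eq_zero.2 hzL
          · by_cases hL : L = []
            · subst hL
              have hzw : z ∉ w := by
                rw [← List.count_eq_zero, hcz]; simp
              cases w with
              | nil => simp
              | cons a w =>
                constructor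
                · intro h; simp at h
                · intro h
                  exfalso
                  rw [getLast?_cons_ne (by simp)] at h
                  exact hzw (List.mem_of_getLast? (by simpa using h))
            · have hw : w ≠ [] := by
                rintro rfl
                obtain ⟨a, ha⟩ := List.exists_mem_of_ne_nil L hL
                have h1 := hc a
                have h2 := List.count_pos_iff.2 ha
                simp at h1
                omega
              rw [getLast?_cons_ne hw, getLast?_cons_ne hL]
        · by_cases hzU : z ∈ U
          · simp only [hzx, hzU, false_and, true_and, false_or]
            have hzL : z ∉ x :: L := fun h => hLU z h hzU
            have hmz := hU z hzU
            rw [ih]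
            · have hcz : (x :: L).count z = 0 := List.count_eq_zero.2 hzL
              have hcnt : Cnt m (List.replicate (m z - 1) z ++ x :: L) (U.erase z) w ↔
                  Cnt m (x :: L) U (z :: w) := by
                unfold Cnt
                refine forall_congr' fun y => ?_
                rw [List.count_append, List.count_replicate, List.count_cons (l := w)]
                by_cases hyz : y = z
                · subst hyz
                  simp [hzU, hcz]
                  omega
                · have hzy : z ≠ y := Ne.symm hyz
                  simp [hyz, hzy]
              rw [hcnt]
              refine and_congr_right fun hc => ?_
              have hw : w ≠ [] := by
                rintro rfl
                have h1 := hc x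
                simp [hzx] at h1
                omega
              apply and_congr
              · rw [List.reverse_append, List.reverse_replicate, List.append_assoc]
                by_cases h1 : m z = 1
                · rw [h1]
                  simp only [Nat.sub_self, List.replicate_zero, List.nil_append]
                  rw [NC_remove]
                  · rwa [List.mem_reverse]
                  · rw [← List.count_eq_zero]
                    have := hc z
                    simp [hzU, hcz, h1] at this
                    simpa using this
                · obtain ⟨c, hc⟩ : ∃ c, m z - 1 = c + 1 := ⟨m z - 2, by omega⟩
                  rw [hc, NC_rep]
              · rw [getLast?_cons_ne hw, List.getLast?_append_of_ne_nil _ (by simp)]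
            · have := len_step m x L U hU z hzU
              simp at hN
              omega
            · exact fun y hy => hU y (Finset.mem_of_mem_erase hy)
            · intro y hy
              rw [List.mem_append] at hy
              rcases hy with hy | hy
              · rw [List.eq_of_mem_replicate hy]; simp
              · exact fun h => hLU y hy (Finset.mem_of_mem_erase h)
            · exact Gr_rep z _ hzL hG _
          · simp only [hzx, hzU, false_and, false_or, false_iff]
            rintro ⟨hc, hn, _⟩
            have h1 := hc z
            have h2 := hc x
            have hxz : x ≠ z := Ne.symm hzx
            simp [hzU, hxz] at h1
            simp [hxU, hzx] at h2
            have hzL : z ∈ L := List.count_pos_iff.1 (by omega)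
            have hxw : x ∈ w := List.count_pos_iff.1 (by omega)
            refine hn z x hzx ?_
            rw [List.reverse_cons, List.append_assoc, List.singleton_append]
            have e1 : List.Sublist [z] L.reverse := by simpa using hzL
            have e2 : List.Sublist [x] w := by simpa using hxw
            exact e1.append ((e2.cons_cons z).cons_cons x)

theorem count_mset (n : ℕ) (m : ℕ → ℕ) (z : ℕ) :
    (msetList n m).count z = if z ∈ Finset.Icc 1 n then m z else 0 := by
  unfold msetList
  induction n with
  | zero =>
    have : ¬ (1 ≤ z ∧ z ≤ 0) := by omega
    simp [this]
  | succ n ih =>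
    rw [List.range_succ, List.flatMap_append, List.count_append, ih]
    simp only [List.flatMap_cons, List.flatMap_nil, List.append_nil, List.count_replicate, Finset.mem_Icc]
    by_cases h : n + 1 = z
    · subst h
      simp
    · have h3 : (z ≤ n + 1) ↔ z ≤ n := by omega
      simp [h, h3]

theorem QS_sum (n : ℕ) (m : ℕ → ℕ) (hm : ∀ y ∈ Finset.Icc 1 n, 1 ≤ m y) (t : R) :
    ∑ w ∈ QS n m, t ^ desN w = Phi m t 0 [0] (Finset.Icc 1 n) := by
  have h0 : ∀ z ∈ [0], z ∉ Finset.Icc 1 n := by simp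
  have hmem := mem_Wd m (([0] : List ℕ).length + ∑ y ∈ Finset.Icc 1 n, m y) [0] (Finset.Icc 1 n)
    rfl hm h0 (by simp [Gr])
  unfold Phi
  rw [← Wd_sum m t _ 0 [0] _ h0]
  have hq : ∀ w, w ∈ QS n m ↔ (∀ z, w.count z = if z ∈ Finset.Icc 1 n then m z else 0) ∧ NC w := by
    intro w
    simp only [QS, Finset.mem_filter, List.mem_toFinset, List.mem_permutations, IsQS_iff,
      List.perm_iff_count, count_mset]
  have hiff : ∀ w, w ++ [0] ∈ Wd m (([0] : List ℕ).length + ∑ y ∈ Finset.Icc 1 n, m y) [0]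
      (Finset.Icc 1 n) ↔ w ∈ QS n m := by
    intro w
    rw [hmem, hq]
    have hc : Cnt m [0] (Finset.Icc 1 n) (w ++ [0]) ↔
        ∀ z, w.count z = if z ∈ Finset.Icc 1 n then m z else 0 := by
      unfold Cnt
      refine forall_congr' fun z => ?_
      rw [List.count_append]
      omega
    rw [hc]
    refine and_congr_right fun hw => ?_
    have h0w : 0 ∉ w := by
      rw [← List.count_eq_zero, hw]; simp
    constructor
    · rintro ⟨h, _⟩
      refine NC_mono ?_ h
      simp only [List.reverse_singleton, List.singleton_append]
      exact (List.sublist_append_left _ _).cons _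
    · intro h
      refine ⟨?_, by simp⟩
      intro a b hab hs
      simp only [List.reverse_singleton, List.singleton_append] at hs
      by_cases ha : a = 0
      · subst ha
        have hcc : List.Sublist [b, 0, b] (w ++ [0]) := hs.of_cons_cons
        rw [List.sublist_append_iff] at hcc
        obtain ⟨l1, l2, h1, h2, h3⟩ := hcc
        have : l2 = [] ∨ l2 = [0] := by simpa [List.sublist_singleton] using h3
        rcases this with rfl | rfl
        · rw [List.append_nil] at h1
          subst h1
          exact h0w (h2.subset (by simp))
        · have := congrArg List.getLast? h1
          simp at this
          exact hab this.symm
      · have hs2 : List.Sublist [a, b, a, b] (w ++ [0]) := by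
          cases hs with
          | cons _ h => exact h
          | cons_cons _ h => exact absurd rfl ha
        rw [List.sublist_append_iff] at hs2
        obtain ⟨l1, l2, h1, h2, h3⟩ := hs2
        have : l2 = [] ∨ l2 = [0] := by simpa [List.sublist_singleton] using h3
        rcases this with rfl | rfl
        · rw [List.append_nil] at h1
          subst h1
          exact h a b hab h2
        · have h4 : b = 0 := by
            have := congrArg List.getLast? h1
            simpa using this
          subst h4
          have h5 := congrArg List.dropLast h1
          simp at h5
          subst h5
          exact h0w (h2.subset (by simp))
  refine Finset.sum_bij (fun w _ => w ++ [0]) ?_ ?_ ?_ ?_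
  · intro w hw; exact (hiff w).2 hw
  · intro a _ b _ h; exact List.append_cancel_right h
  · intro w hw
    have h1 := ((hmem w).1 hw).2.2
    simp only [List.getLast?_singleton, List.getLast?_eq_some_iff] at h1
    obtain ⟨v, rfl⟩ := h1
    exact ⟨v, (hiff v).1 hw, rfl⟩
  · intro w _; exact pow_desN t w

end Words

section Blocks

/-- words using each letter of `S` exactly once -/
noncomputable def PS (S : Finset ℕ) : Finset (List ℕ) := S.toList.permutations.toFinset

theorem mem_PS (S : Finset ℕ) (w : List ℕ) : w ∈ PS S ↔ w.Nodup ∧ w.toFinset = S := by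
  unfold PS
  rw [List.mem_toFinset, List.mem_permutations]
  constructor
  · intro h
    refine ⟨h.nodup_iff.2 S.nodup_toList, ?_⟩
    rw [List.toFinset_eq_of_perm _ _ h, Finset.toList_toFinset]
  · rintro ⟨h1, rfl⟩
    refine List.perm_of_nodup_nodup_toFinset_eq h1 (Finset.nodup_toList _) ?_
    rw [Finset.toList_toFinset]

theorem PS_length {S : Finset ℕ} {w : List ℕ} (h : w ∈ PS S) : w.length = S.card := by
  rw [mem_PS] at h
  rw [← h.2, List.toFinset_card_of_nodup h.1]

theorem Sn_eq (n : ℕ) : Sn n = PS (Finset.Icc 1 n) := by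
  ext w
  unfold Sn
  rw [mem_PS, List.mem_toFinset, List.mem_permutations]
  have e : (List.range' 1 n).toFinset = Finset.Icc 1 n := by
    ext a
    simp [List.mem_range'_1]
    omega
  constructor
  · intro h
    refine ⟨h.nodup_iff.2 List.nodup_range', ?_⟩
    rw [List.toFinset_eq_of_perm _ _ h, e]
  · rintro ⟨h1, h2⟩
    exact List.perm_of_nodup_nodup_toFinset_eq h1 List.nodup_range' (by rw [h2, e])

theorem PS_empty : PS ∅ = {[]} := by
  ext w
  rw [mem_PS]
  constructor
  · rintro ⟨_, h⟩
    simpa using h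
  · intro h
    simp at h
    simp [h]

theorem PS_step (S : Finset ℕ) (hS : S.Nonempty) :
    PS S = S.biUnion fun y => (PS (S.erase y)).image (fun w => y :: w) := by
  ext w
  simp only [Finset.mem_biUnion, Finset.mem_image, mem_PS]
  constructor
  · rintro ⟨h1, rfl⟩
    cases w with
    | nil => simp at hS
    | cons y w =>
      rw [List.nodup_cons] at h1
      refine ⟨y, by simp, w, ⟨h1.2, ?_⟩, rfl⟩
      rw [List.toFinset_cons, Finset.erase_insert (by simpa using h1.1)]
  · rintro ⟨y, hy, v, ⟨h1, h2⟩, rfl⟩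
    constructor
    · rw [List.nodup_cons]
      refine ⟨?_, h1⟩
      intro h
      rw [← List.mem_toFinset, h2] at h
      simp at h
    · rw [List.toFinset_cons, h2, Finset.insert_erase hy]

variable {R : Type*} [CommRing R]

theorem PS_sum (t : R) (x : ℕ) (n : ℕ) : ∀ (p : ℕ) (S : Finset ℕ), S.card = n →
    ∑ w ∈ PS S, wt t p (w ++ [x]) = aP t p x S := by
  induction n with
  | zero =>
    intro p S hS
    rw [Finset.card_eq_zero] at hS
    subst hS
    simp [PS_empty, aP_empty, wt]
  | succ n ih =>
    intro p S hS
    have hne : S.Nonempty := by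
      rw [← Finset.card_pos]; omega
    have hinj : ∀ (y : ℕ) (s : Set (List ℕ)), Set.InjOn (fun w => y :: w) s := by
      intro y s a _ b _ h
      simpa using h
    rw [PS_step S hne, aP_ne t p x hne, Finset.sum_biUnion]
    · refine Finset.sum_congr rfl fun y hy => ?_
      rw [Finset.sum_image (hinj _ _)]
      simp only [List.cons_append, wt, ← Finset.mul_sum]
      rw [ih y (S.erase y) (by rw [Finset.card_erase_of_mem hy]; omega)]
    · intro a _ b _ hab
      rw [Function.onFun, Finset.disjoint_left]
      intro w h1 h2
      simp only [Finset.mem_image] at h1 h2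
      obtain ⟨u, _, rfl⟩ := h1
      obtain ⟨v, _, h⟩ := h2
      simp at h
      exact hab h.1.symm

theorem PS_des (t : R) (T : Finset ℕ) (h0 : 0 ∉ T) :
    ∑ u ∈ PS T, t ^ desN u = Aj t T.card := by
  simp only [pow_desN]
  rw [PS_sum t 0 _ 0 T rfl, aP_cyc t 0 T h0]

theorem offset_zero {k : ℕ} (c : Fin (k + 1) → ℕ) : offsetC c 0 = 0 := by
  simp [offsetC]

theorem offset_succ {k : ℕ} (c : Fin (k + 1) → ℕ) (i : Fin k) :
    offsetC c i.succ = c 0 + offsetC (Fin.tail c) i := by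
  unfold offsetC
  rw [Finset.sum_filter, Finset.sum_filter, Fin.sum_univ_succ]
  simp [Fin.tail]

theorem block_zero {k : ℕ} (w : List ℕ) (c : Fin (k + 1) → ℕ) :
    blockOf (k + 1) w c 0 = w.take (c 0) := by
  simp [blockOf, offset_zero]

theorem block_succ {k : ℕ} (w : List ℕ) (c : Fin (k + 1) → ℕ) (i : Fin k) :
    blockOf (k + 1) w c i.succ = blockOf k (w.drop (c 0)) (Fin.tail c) i := by
  simp only [blockOf, offset_succ, List.drop_drop]
  rfl

theorem desB_succ {k : ℕ} (w : List ℕ) (c : Fin (k + 1) → ℕ) :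
    desB (w, c) = desN (w.take (c 0)) + desB (w.drop (c 0), Fin.tail c) := by
  simp only [desB, Fin.sum_univ_succ, block_zero, block_succ]

/-- generating function of the ordered set partitions of `S` -/
noncomputable def BS (t : R) (k : ℕ) (S : Finset ℕ) : R :=
  ∑ P ∈ PS S ×ˢ Finset.Nat.antidiagonalTuple k S.card, t ^ desB P

theorem BS_zero (t : R) (S : Finset ℕ) : BS t 0 S = if S.card = 0 then 1 else 0 := by
  unfold BS
  by_cases h : S.card = 0
  · have : S = ∅ := by simpa using h
    subst this
    simp [PS_empty, desB]
  · obtain ⟨j, hj⟩ : ∃ j, S.card = j + 1 := ⟨S.card - 1, by omega⟩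
    rw [hj]
    simp

theorem BS_succ (t : R) (k : ℕ) (S : Finset ℕ) :
    BS t (k + 1) S = sconv (fun T => ∑ u ∈ PS T, t ^ desN u) (BS t k) S := by
  unfold BS sconv
  simp only [Finset.sum_mul_sum]
  simp only [← Finset.sum_product']
  rw [Finset.sum_sigma']
  refine Finset.sum_bij'
    (fun P _ => (⟨(P.1.take (P.2 0)).toFinset, (P.1.take (P.2 0), (P.1.drop (P.2 0), Fin.tail P.2))⟩ :
      (_ : Finset ℕ) × (List ℕ × (List ℕ × (Fin k → ℕ)))))
    (fun Q _ => (Q.2.1 ++ Q.2.2.1, Fin.cons Q.2.1.length Q.2.2.2)) ?_ ?_ ?_ ?_ ?_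
  · rintro ⟨w, c⟩ h
    rw [Finset.mem_product, Finset.Nat.mem_antidiagonalTuple] at h
    obtain ⟨h1, h2⟩ := h
    dsimp only at h1 h2 ⊢
    have hl := PS_length h1
    rw [mem_PS] at h1
    obtain ⟨h1, h3⟩ := h1
    have hd : (w.drop (c 0)).toFinset = S \ (w.take (c 0)).toFinset := by
      have e := List.take_append_drop (c 0) w
      rw [← e, List.nodup_append'] at h1
      rw [← e, List.toFinset_append] at h3
      rw [← h3]
      ext a
      simp only [Finset.mem_sdiff, Finset.mem_union, List.mem_toFinset]
      have := @h1.2.2 a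
      tauto
    have hnd : (w.drop (c 0)).Nodup := h1.sublist (List.drop_sublist _ _)
    have hm : w.drop (c 0) ∈ PS (S \ (w.take (c 0)).toFinset) := by
      rw [mem_PS]; exact ⟨hnd, hd⟩
    simp only [Finset.mem_sigma, Finset.mem_product, Finset.mem_powerset]
    refine ⟨?_, ?_, hm, ?_⟩
    · rw [← h3]
      intro a ha
      rw [List.mem_toFinset] at ha ⊢
      exact List.mem_of_mem_take ha
    · rw [mem_PS]
      exact ⟨h1.sublist (List.take_sublist _ _), rfl⟩
    · rw [Finset.Nat.mem_antidiagonalTuple, ← PS_length hm, List.length_drop, hl, ← h2,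
        Fin.sum_univ_succ]
      simp [Fin.tail]
  · rintro ⟨T, u, v, c⟩ h
    simp only [Finset.mem_sigma, Finset.mem_product, Finset.mem_powerset,
      Finset.Nat.mem_antidiagonalTuple] at h ⊢
    obtain ⟨hT, hu, hv, hc⟩ := h
    have hlu := PS_length hu
    rw [mem_PS] at hu hv
    constructor
    · rw [mem_PS, List.nodup_append', List.toFinset_append, hu.2, hv.2]
      refine ⟨⟨hu.1, hv.1, ?_⟩, Finset.union_sdiff_of_subset hT⟩
      intro a ha hb
      rw [← List.mem_toFinset, hu.2] at ha
      rw [← List.mem_toFinset, hv.2] at hb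
      simp at hb
      exact hb.2 ha
    · rw [Fin.sum_univ_succ]
      simp only [Fin.cons_zero, Fin.cons_succ]
      rw [hc, hlu, Finset.card_sdiff_of_subset hT]
      have := Finset.card_le_card hT
      omega
  · rintro ⟨w, c⟩ h
    rw [Finset.mem_product, Finset.Nat.mem_antidiagonalTuple] at h
    obtain ⟨h1, h2⟩ := h
    have hl := PS_length h1
    dsimp only at h1 h2 hl ⊢
    have hle : c 0 ≤ w.length := by
      rw [hl, ← h2, Fin.sum_univ_succ]; omega
    rw [List.take_append_drop, List.length_take, min_eq_left hle, Fin.cons_self_tail]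
  · rintro ⟨T, u, v, c⟩ h
    simp only [Finset.mem_sigma, Finset.mem_product, Finset.mem_powerset] at h
    have hu := h.2.1
    rw [mem_PS] at hu
    simp [hu.2]
  · rintro ⟨w, c⟩ h
    dsimp only
    rw [desB_succ, pow_add]

theorem BS_eq [Algebra ℚ R] (t : R) (k : ℕ) : ∀ S : Finset ℕ, 0 ∉ S →
    BS t k S = Fnk t S.card k := by
  induction k with
  | zero => intro S _; rw [BS_zero, Fnk_zero]
  | succ k ih =>
    intro S hS
    rw [BS_succ, Fnk_sconv]
    exact sconv_congr (fun T hT => PS_des t T fun h => hS (hT h))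
      (fun T hT => ih T fun h => hS (hT h))

theorem Bnk_sum [Algebra ℚ R] (t : R) (n k : ℕ) : ∑ P ∈ Bnk n k, t ^ desB P = Fnk t n k := by
  have h := BS_eq t k (Finset.Icc 1 n) (by simp)
  unfold BS at h
  rw [← Sn_eq, Nat.card_Icc, Nat.add_sub_cancel] at h
  exact h

end Blocks

section Bars

theorem bars_gen (N : ℕ) (D : Finset (Fin N)) :
    (PowerSeries.mk fun m => ((((Finset.Nat.antidiagonalTuple N m).filter
      fun b => ∀ g ∈ D, 1 ≤ b g).card : ℕ) : ℚ)) =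
      PowerSeries.X ^ D.card * ((1 - PowerSeries.X) ^ N)⁻¹ := by
  set f : Fin N → PowerSeries ℚ := fun g =>
    PowerSeries.mk fun j => if g ∈ D ∧ j = 0 then 0 else 1 with hf
  have h1 : ∀ g, f g * (1 - PowerSeries.X) = if g ∈ D then PowerSeries.X else 1 := by
    intro g
    ext j
    rw [mul_sub, mul_one, map_sub]
    rcases j with _ | j
    · rw [PowerSeries.coeff_zero_mul_X]
      by_cases hg : g ∈ D <;> simp [hf, hg]
    · rw [PowerSeries.coeff_succ_mul_X]
      by_cases hg : g ∈ D
      · simp only [hf, hg, PowerSeries.coeff_mk, if_true, PowerSeries.coeff_X, true_and]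
        rcases j with _ | j <;> simp
      · simp [hf, hg, PowerSeries.coeff_one]
  have h2 : (∏ g, f g) * (1 - PowerSeries.X) ^ N = PowerSeries.X ^ D.card := by
    have : (1 - PowerSeries.X : PowerSeries ℚ) ^ N = ∏ _g : Fin N, (1 - PowerSeries.X) := by
      simp
    rw [this, ← Finset.prod_mul_distrib, Finset.prod_congr rfl fun g _ => h1 g,
      Finset.prod_ite_mem, Finset.univ_inter, Finset.prod_const]
  have h3 : (PowerSeries.mk fun m => ((((Finset.Nat.antidiagonalTuple N m).filter
      fun b => ∀ g ∈ D, 1 ≤ b g).card : ℕ) : ℚ)) = ∏ g, f g := by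
    ext m
    rw [PowerSeries.coeff_mk, PowerSeries.coeff_prod, Finset.card_filter, Nat.cast_sum]
    symm
    refine Finset.sum_bij' (fun l _ => (l : Fin N → ℕ))
      (fun b _ => Finsupp.equivFunOnFinite.symm b) ?_ ?_ ?_ ?_ ?_
    · intro l hl
      rw [Finset.mem_finsuppAntidiag] at hl
      rw [Finset.Nat.mem_antidiagonalTuple]
      exact hl.1
    · intro b hb
      rw [Finset.Nat.mem_antidiagonalTuple] at hb
      rw [Finset.mem_finsuppAntidiag]
      exact ⟨by simpa using hb, by simp⟩
    · intro l _
      ext i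
      rfl
    · intro b _
      rfl
    · intro l _
      by_cases h : ∀ g ∈ D, 1 ≤ l g
      · rw [if_pos h, Nat.cast_one]
        refine Finset.prod_eq_one fun g _ => ?_
        rw [hf, PowerSeries.coeff_mk, if_neg]
        rintro ⟨h4, h5⟩
        have := h g h4
        omega
      · rw [if_neg h, Nat.cast_zero]
        push Not at h
        obtain ⟨g, hg, h0⟩ := h
        refine Finset.prod_eq_zero (Finset.mem_univ g) ?_
        rw [hf, PowerSeries.coeff_mk, if_pos ⟨hg, by omega⟩]
  rw [h3, PowerSeries.eq_mul_inv_iff_mul_eq, h2]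
  simp

theorem sum_lt_add {k : ℕ} (f : Fin k → ℕ) (i : Fin k) (s : Finset (Fin k))
    (hs : ∀ j : Fin k, (j : ℕ) ≤ (i : ℕ) → j ∈ s) :
    (∑ j ∈ Finset.univ.filter (fun j : Fin k => (j : ℕ) < (i : ℕ)), f j) + f i ≤ ∑ j ∈ s, f j := by
  rw [add_comm, ← Finset.sum_insert (by simp)]
  apply Finset.sum_le_sum_of_subset
  intro j hj
  rw [Finset.mem_insert, Finset.mem_filter] at hj
  apply hs
  rcases hj with rfl | hj
  · exact le_rfl
  · exact hj.2.le

theorem block_len {n k : ℕ} (w : List ℕ) (c : Fin k → ℕ) (hw : w.length = n) (hc : ∑ i, c i = n)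
    (i : Fin k) : (blockOf k w c i).length = c i := by
  have := sum_lt_add c i Finset.univ (by simp)
  rw [hc] at this
  unfold blockOf offsetC
  rw [List.length_take, List.length_drop, hw]
  omega

theorem gap_lt {k : ℕ} (c : Fin k → ℕ) (i i' : Fin k) (j j' : ℕ) (hj : j ≤ c i)
    (h : (i : ℕ) < (i' : ℕ)) : gapIdx c i j < gapIdx c i' j' := by
  unfold gapIdx
  have := sum_lt_add (fun j => c j + 1) i
    (Finset.univ.filter (fun j : Fin k => (j : ℕ) < (i' : ℕ)))
    (by intro a ha; simp only [Finset.mem_filter, Finset.mem_univ, true_and]; omega)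
  omega

theorem gap_bd {n k : ℕ} (c : Fin k → ℕ) (hc : ∑ i, c i = n) (i : Fin k) (j : ℕ) (hj : j ≤ c i) :
    gapIdx c i j < n + k := by
  unfold gapIdx
  have := sum_lt_add (fun j => c j + 1) i Finset.univ (by simp)
  have h2 : ∑ j, (c j + 1) = n + k := by
    rw [Finset.sum_add_distrib, hc]
    simp
  rw [h2] at this
  omega

theorem bars_one (n k : ℕ) (w : List ℕ) (c : Fin k → ℕ) (hw : w.length = n)
    (hc : ∑ i, c i = n) :
    (PowerSeries.mk fun m => ((((Finset.Nat.antidiagonalTuple (n + k) m).filter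
      (GoodBars n k w c)).card : ℕ) : ℚ)) =
      PowerSeries.X ^ desB (w, c) * ((1 - PowerSeries.X) ^ (n + k))⁻¹ := by
  set D : Finset (Fin (n + k)) := Finset.univ.filter fun g => ∃ i : Fin k, ∃ j : ℕ, j ≤ c i ∧
    pad (blockOf k w c i) (j + 1) < pad (blockOf k w c i) j ∧ (g : ℕ) = gapIdx c i j with hD
  have hG : ∀ b : Fin (n + k) → ℕ, GoodBars n k w c b ↔ ∀ g ∈ D, 1 ≤ b g := by
    intro b
    constructor
    · intro h g hg
      rw [hD, Finset.mem_filter] at hg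
      obtain ⟨_, i, j, hj, hd, hg⟩ := hg
      exact h i j hj hd g hg
    · intro h i j hj hd g hg
      apply h
      rw [hD, Finset.mem_filter]
      exact ⟨Finset.mem_univ _, i, j, hj, hd, hg⟩
  have hcard : desB (w, c) = D.card := by
    unfold desB desN
    dsimp only
    rw [← Finset.card_sigma]
    refine Finset.card_bij
      (fun p hp => ⟨gapIdx c p.1 p.2, gap_bd c hc p.1 p.2 ?_⟩) ?_ ?_ ?_
    · simp only [Finset.mem_sigma, Finset.mem_filter, Finset.mem_range,
        block_len w c hw hc] at hp
      omega
    · rintro ⟨i, j⟩ hp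
      simp only [Finset.mem_sigma, Finset.mem_filter, Finset.mem_range,
        block_len w c hw hc] at hp
      rw [hD, Finset.mem_filter]
      exact ⟨Finset.mem_univ _, i, j, by omega, hp.2.2, rfl⟩
    · rintro ⟨i, j⟩ hp ⟨i', j'⟩ hp' h
      simp only [Finset.mem_sigma, Finset.mem_filter, Finset.mem_range,
        block_len w c hw hc] at hp hp'
      simp only [Fin.mk.injEq] at h
      rcases lt_trichotomy (i : ℕ) (i' : ℕ) with h1 | h1 | h1
      · have := gap_lt c i i' j j' (by omega) h1
        omega
      · have := Fin.ext h1
        subst this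
        unfold gapIdx at h
        have : j = j' := by omega
        rw [this]
      · have := gap_lt c i' i j' j (by omega) h1
        omega
    · intro g hg
      rw [hD, Finset.mem_filter] at hg
      obtain ⟨_, i, j, hj, hd, hg⟩ := hg
      refine ⟨⟨i, j⟩, ?_, Fin.ext hg.symm⟩
      simp only [Finset.mem_sigma, Finset.mem_filter, Finset.mem_range,
        block_len w c hw hc]
      exact ⟨Finset.mem_univ _, by omega, hd⟩
  rw [hcard, ← bars_gen]
  simp only [hG]

theorem bars_all (n k : ℕ) :
    (PowerSeries.mk fun m => ((∑ P ∈ Bnk n k, ((Finset.Nat.antidiagonalTuple (n + k) m).filter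
      (GoodBars n k P.1 P.2)).card : ℕ) : ℚ)) =
      (∑ P ∈ Bnk n k, PowerSeries.X ^ desB P) * ((1 - PowerSeries.X) ^ (n + k))⁻¹ := by
  rw [Finset.sum_mul]
  have : ∀ P ∈ Bnk n k, PowerSeries.X ^ desB P * ((1 - PowerSeries.X) ^ (n + k))⁻¹ =
      (PowerSeries.mk fun m => ((((Finset.Nat.antidiagonalTuple (n + k) m).filter
      (GoodBars n k P.1 P.2)).card : ℕ) : ℚ)) := by
    rintro ⟨w, c⟩ hP
    rw [Bnk, Finset.mem_product, Finset.Nat.mem_antidiagonalTuple, Sn_eq] at hP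
    rw [bars_one n k w c (by simpa using PS_length hP.1) hP.2]
  rw [Finset.sum_congr rfl this]
  ext m
  rw [map_sum, PowerSeries.coeff_mk, Nat.cast_sum]
  simp only [PowerSeries.coeff_mk]

end Bars
/-- `(M−n+1)·Q̄_M(t)/(1−t)^{M+1} = Σ_{Π ∈ B̄_{n,k}} t^{bar(Π)}` with
`k = M − n + 1`. -/
theorem stmt12 (n : ℕ) (mlt : ℕ → ℕ) (hm : ∀ i, 1 ≤ i → i ≤ n → 1 ≤ mlt i) :
    ((((∑ i ∈ Finset.range n, mlt (i + 1)) - n + 1 : ℕ)) : PowerSeries ℚ) *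
        (∑ w ∈ QS n mlt, (PowerSeries.X : PowerSeries ℚ) ^ desN w) *
        ((1 - PowerSeries.X) ^ ((∑ i ∈ Finset.range n, mlt (i + 1)) + 1))⁻¹ =
      PowerSeries.mk fun m =>
        ((∑ P ∈ Bnk n ((∑ i ∈ Finset.range n, mlt (i + 1)) - n + 1),
          ((Finset.Nat.antidiagonalTuple
              (n + ((∑ i ∈ Finset.range n, mlt (i + 1)) - n + 1)) m).filter
            (GoodBars n ((∑ i ∈ Finset.range n, mlt (i + 1)) - n + 1) P.1 P.2)).card : ℕ) :
          ℚ) := by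
  have hle : ∀ y ∈ Finset.Icc 1 n, 1 ≤ mlt y := by
    intro y hy
    rw [Finset.mem_Icc] at hy
    exact hm y hy.1 hy.2
  have hs : ∑ i ∈ Finset.range n, mlt (i + 1) = ∑ y ∈ Finset.Icc 1 n, mlt y := by
    rw [Finset.range_eq_Ico, Finset.sum_Ico_add' mlt 0 n 1]
    rfl
  have hs1 : ∑ y ∈ Finset.Icc 1 n, mlt y = ∑ y ∈ Finset.Icc 1 n, (mlt y - 1) + n := by
    have e : ∀ y ∈ Finset.Icc 1 n, mlt y = (mlt y - 1) + 1 := by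
      intro y hy
      have := hle y hy
      omega
    rw [Finset.sum_congr rfl e, Finset.sum_add_distrib]
    simp
  have hQ := QS_sum n mlt hle (PowerSeries.X : PowerSeries ℚ)
  rw [Phi_main mlt _ (Finset.Icc 1 n) hle (by simp)] at hQ
  rw [hQ, hs, hs1]
  set s := ∑ y ∈ Finset.Icc 1 n, (mlt y - 1) with hsdef
  rw [Nat.add_sub_cancel, bars_all, Bnk_sum]
  have e2 : n + (s + 1) = s + n + 1 := by omega
  rw [e2]
  congr 1
  unfold ES Ev
  rw [if_neg (by omega), ← hsdef, Nat.card_Icc, Nat.add_sub_cancel, add_comm 1 s]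
  have hne : ((s : ℚ) + 1) ≠ 0 := by positivity
  rw [← nsmul_eq_mul, ← Nat.cast_smul_eq_nsmul ℚ, smul_smul]
  have e3 : (((s + 1 : ℕ) : ℚ) * (((1 : ℕ) : ℚ) / (((1 : ℕ) : ℚ) + s))) = 1 := by
    push_cast
    rw [add_comm (1 : ℚ)]
    field_simp
  rw [e3, one_smul]
end
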